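/- arXiv:2109.13485 — 2 statements merged into one kernel-verified Lean document; each statement's English description precedes it below -/
import Mathlib

section
/- (Bóna) The Stanley–Wilf growth constant of the pattern 31245 equals 9 + 4√2: lim_{n→∞} (s_n(31245))^{1/n} = 9 + 4√2, where s_n(31245) is the number of permutations of {1,…,n} avoiding the pattern 31245. -/
open Filter

/-- `π` contains the pattern `τ`: some subsequence of `π` of length `k` has its
entries in the same relative order as `τ`. -/
def PattContains {k n : ℕ} (τ : Equiv.Perm (Fin k)) (π : Equiv.Perm (Fin n)) : Prop :=
  ∃ f : Fin k → Fin n, StrictMono f ∧ ∀ a b : Fin k, π (f a) < π (f b) ↔ τ a < τ b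

/-- `avoidCount τ n` is the number of permutations of `{1, …, n}` avoiding the
pattern `τ`. -/
noncomputable def avoidCount {k : ℕ} (τ : Equiv.Perm (Fin k)) (n : ℕ) : ℕ :=
  Nat.card {π : Equiv.Perm (Fin n) // ¬ PattContains τ π}

/-- The pattern `31245`, i.e. the permutation of `{1,…,5}` sending
`1↦3, 2↦1, 3↦2, 4↦4, 5↦5` (written here 0-indexed on `Fin 5`). -/
noncomputable def patt31245 : Equiv.Perm (Fin 5) :=
  Equiv.ofBijective ![2, 0, 1, 3, 4] (by decide)

section PowerSeries

open PowerSeries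

theorem exists_eq_one_add_mul_sq {S : Type*} [CommRing S] (z : S⟦X⟧)
    (hz : constantCoeff z = 0) : ∃ K : S⟦X⟧, K = 1 + z * K ^ 2 := by
  have ha : HasSubst z := HasSubst.of_constantCoeff_zero' hz
  have h := congrArg (PowerSeries.map (Nat.castRingHom ℤ)) catalanSeries_sq_mul_X_add_one
  refine ⟨substAlgHom (R := ℤ) ha (PowerSeries.map (Nat.castRingHom ℤ) catalanSeries), ?_⟩
  have hsubst := congrArg (substAlgHom (R := ℤ) ha) h
  simp only [map_add, map_mul, map_pow, map_one, map_X, substAlgHom_X] at hsubst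
  linear_combination -hsubst

/-- The generating function of binary trees with a factor `2` for each node; it solves
`U = X + 2 * U ^ 2`. -/
noncomputable def catU : ℝ⟦X⟧ := X * rescale 2 (PowerSeries.map (Nat.castRingHom ℝ) catalanSeries)

theorem catU_eq : catU = X + 2 * catU ^ 2 := by
  have h := congrArg (fun f => rescale (2:ℝ) (PowerSeries.map (Nat.castRingHom ℝ) f))
    catalanSeries_sq_mul_X_add_one
  simp only [map_add, map_mul, map_pow, map_one, map_X, rescale_X] at h
  have h2 : (C (2:ℝ) : ℝ⟦X⟧) = 2 := map_ofNat C 2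
  rw [h2] at h
  rw [catU]
  linear_combination -X * h

theorem coeff_succ_catU (n : ℕ) : coeff (n+1) catU = 2 ^ n * (catalan n : ℝ) := by
  simp [catU, coeff_succ_X_mul, coeff_rescale]

theorem coeff_zero_catU : coeff 0 catU = 0 := by
  simp [catU]

theorem weight_alg {S : Type*} [CommRing S] (u U a b G K W : S) (ha : (1 - 2 * U) * a = 1)
    (hb : (1 - U) * b = 1) (hG : G * (1 - u) = 1)
    (hK : K = 1 + (1 - U) * a ^ 2 * U * u * G * K ^ 2) (hW : W = G * K * (u - U)) :
    u * (a + (1 - U) * a ^ 2 * W) =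
      u * G + U * b ^ 2 * (U + W) * (1 + u * (a + (1 - U) * a ^ 2 * W)) := by
  have h1 : (1 - U) * a ^ 2 * U * u * W ^ 2 = (u - U) * W - (u - U) ^ 2 * G := by
    subst hW
    linear_combination -(u - U) ^ 2 * G * hK
  have h2 : (u - U) ^ 2 * G = (1 - U) ^ 2 * G - 1 - u + 2 * U := by
    linear_combination (- u - 1 + 2 * U) * hG
  have h3 : 1 + U ^ 2 * a = a * (1 - U) ^ 2 := by linear_combination -ha
  have h4 : 1 + U * a = (1 - U) * a := by linear_combination -ha
  have h5 : b ^ 2 * (1 - U) ^ 2 = 1 := by rw [← mul_pow, mul_comm b, hb, one_pow]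
  have h6 : b ^ 2 * (1 + U ^ 2 * a) = a := by rw [h3]; linear_combination a * h5
  have h7 : b ^ 2 * (1 + U * a) + U ^ 2 * b ^ 2 * ((1 - U) * a ^ 2) = (1 - U) * a ^ 2 := by
    linear_combination b ^ 2 * h4 + (1 - U) * a * h6
  linear_combination - (b ^ 2) * h1 + b ^ 2 * h2 + hG + G * h5 - h5 - u * h6 - u * W * h7

/-- Weights `A r` such that the product of the weights of the parts of a stack is the generating
function of its descendants, up to the common factor `c`. -/
theorem exists_weights : ∃ (c : ℝ⟦X⟧) (A : ℕ → ℝ⟦X⟧), A 0 = 1 ∧ c = 1 + X * c * A 1 ∧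
    (∀ n, A (n+1) = 1 + X * c * ∑ p ∈ Finset.HasAntidiagonal.antidiagonal n, A (p.1 + 2) * A p.2) ∧
    c * (1 - catU) ^ 3 = 1 - 2 * catU := by
  set U := catU with hU
  have hUe : U = X + 2 * U ^ 2 := catU_eq
  have hU0 : constantCoeff U = 0 := by simpa using coeff_zero_catU
  obtain ⟨α, hα⟩ : ∃ α, (1 - 2 * U) * α = 1 := ⟨(1-2*U)⁻¹, PowerSeries.mul_inv_cancel _ (by simp [hU0])⟩
  obtain ⟨β, hβ⟩ : ∃ β, (1 - U) * β = 1 := ⟨(1-U)⁻¹, PowerSeries.mul_inv_cancel _ (by simp [hU0])⟩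
  set κ := (1 - U) * α ^ 2 with hκ
  set c := (1 - 2 * U) * β ^ 3 with hc
  set G : ℝ⟦X⟧⟦X⟧ := PowerSeries.mk 1 with hG
  have hG1 : G * (1 - X) = 1 := PowerSeries.mk_one_mul_one_sub_eq_one _
  obtain ⟨K, hK⟩ := exists_eq_one_add_mul_sq (C (κ * U) * X * G) (by simp)
  obtain ⟨E, hE⟩ : ∃ E : ℝ⟦X⟧⟦X⟧, E = 1 + C α * X - C (κ * U) * X * G * K + C κ * X ^ 2 * G * K :=
    ⟨_, rfl⟩
  have hX : X = U - 2 * U ^ 2 := by linear_combination -hUe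
  have e0 : coeff 0 E = 1 := by
    simp [hE]
  have hK0 : constantCoeff K = 1 := by rw [hK]; simp
  have e1 : coeff 1 E = α - κ * U := by
    have : coeff 1 (C (κ * U) * X * G * K) = κ * U := by
      rw [show C (κ * U) * X * G * K = X * (C (κ * U) * G * K) by ring,
        show (1:ℕ) = 0 + 1 from rfl, coeff_succ_X_mul]
      simp [hK0, hG]
    have h2 : coeff 1 (C κ * X ^ 2 * G * K) = 0 := by
      rw [show C κ * X ^ 2 * G * K = X * (X * (C κ * G * K)) by ring,
        show (1:ℕ) = 0 + 1 from rfl, coeff_succ_X_mul]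
      simp
    have h3 : coeff 1 (C α * X : ℝ⟦X⟧⟦X⟧) = α := by
      simp
    rw [hE]; simp only [map_add, map_sub, this, h2, h3]; simp [coeff_one]
  have hcβ : c * (1 - U) ^ 3 = 1 - 2 * U := by
    rw [hc]
    have : (1 - U) ^ 3 * β ^ 3 = 1 := by rw [← mul_pow, hβ, one_pow]
    linear_combination (1 - 2 * U) * this
  have hXα : X * α = U := by rw [hX]; linear_combination U * hα
  have hsum : β ^ 2 * (1 + U ^ 2 * α) = α := by
    have h5 : β ^ 2 * (1 - U) ^ 2 = 1 := by rw [← mul_pow, mul_comm β, hβ, one_pow]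
    linear_combination α * h5 - β ^ 2 * hα
  have hc1 : c = 1 + X * c * (α - κ * U) := by
    rw [hκ, hc]
    linear_combination (-(1 - 2 * U) * β ^ 3 * (1 - (1 - U) * α * U)) * hXα
      + (1 - 2 * U) * β ^ 2 * (1 + U ^ 2 * α) * hβ + (1 - 2 * U) * hsum + hα
  have hyκ : X * c * κ = U * β ^ 2 := by
    rw [hκ, hc]
    linear_combination (1 - 2 * U) * β ^ 3 * (1 - U) * α * hXα
      + U * β ^ 3 * (1 - U) * hα + U * β ^ 2 * hβ
  have key : X * (X * (PowerSeries.mk fun n => coeff (n+1) E)) = X * (X * (G +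
      C (X * c) * (PowerSeries.mk fun n => coeff (n+2) E) * E)) := by
    have hE0 := eq_X_mul_shift_add_const E
    have hE1 := eq_X_mul_shift_add_const (PowerSeries.mk fun n => coeff (n+1) E)
    have e0' : constantCoeff E = 1 := by simpa using e0
    have e1' : constantCoeff (PowerSeries.mk fun n => coeff (n+1) E) = α - κ * U := by
      simpa using e1
    simp only [coeff_mk] at hE1
    rw [e0', map_one] at hE0
    rw [e1'] at hE1
    have h2 : (C (2 : ℝ⟦X⟧) : ℝ⟦X⟧⟦X⟧) = 2 := map_ofNat C 2
    have hw := weight_alg (X : ℝ⟦X⟧⟦X⟧) (C U) (C α) (C β) G K (G * K * (X - C U))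
      (by simpa [h2] using congrArg C hα) (by simpa using congrArg C hβ) hG1
      (by rw [hκ] at hK; simpa using hK) rfl
    have hy := congrArg (C (R := ℝ⟦X⟧)) hyκ
    have hκ' := congrArg (C (R := ℝ⟦X⟧)) hκ
    simp only [map_mul, map_pow, map_sub, map_one] at hy hκ' hE1 hE hw ⊢
    generalize (PowerSeries.mk fun n => coeff (n+1) E) = E1 at *
    generalize (PowerSeries.mk fun n => coeff (n+1+1) E) = E2 at *
    rw [← hκ'] at hw
    have hE' : E = 1 + X * (C α + C κ * (G * K * (X - C U))) := by linear_combination hE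
    have hp : X * E1 = X * (C α + C κ * (G * K * (X - C U))) := by
      linear_combination hE' - hE0
    have hq : X ^ 2 * E2 = C κ * X * (C U + G * K * (X - C U)) := by
      linear_combination hp - X * hE1
    linear_combination X * hp + X * hw - C X * C c * E * hq
      - (C U + G * K * (X - C U)) * X * E * hy
      - C U * C β ^ 2 * (C U + G * K * (X - C U)) * X * hE'
  have key' := mul_left_cancel₀ (X_ne_zero) (mul_left_cancel₀ X_ne_zero key)
  refine ⟨c, fun r => coeff r E, e0, by simpa only [e1] using hc1, fun n => ?_, hcβ⟩
  have h := congrArg (coeff n) key'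
  rw [coeff_mk, map_add, mul_assoc, coeff_C_mul, coeff_mul] at h
  simpa [hG] using h

/-- The elementary moves on a stack that do not push a fresh part on top. -/
def stackMoves : List ℕ → List (List ℕ)
  | [] => []
  | r :: s => (List.range r).map (fun i => (i + 2) :: (r - 1 - i) :: s) ++ stackMoves s

/-- The successors of a stack in the generating tree. -/
def stackSucc (s : List ℕ) : List (List ℕ) := (1 :: s) :: stackMoves s

/-- The `n`-th level of the generating tree rooted at the empty stack. -/
def stackLevel : ℕ → List (List ℕ)
  | 0 => [[]]
  | n + 1 => (stackLevel n).flatMap stackSucc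

section Weights

variable {c : ℝ⟦X⟧} {A : ℕ → ℝ⟦X⟧}

theorem sum_stackMoves (hA0 : A 0 = 1)
    (hA : ∀ n, A (n+1) = 1 + X * c * ∑ p ∈ Finset.HasAntidiagonal.antidiagonal n,
      A (p.1 + 2) * A p.2) (s : List ℕ) :
    (s.map A).prod = 1 + X * c * ((stackMoves s).map fun t => (t.map A).prod).sum := by
  induction s with
  | nil => simp [stackMoves]
  | cons r s ih =>
    have hr : A r = 1 + X * c * ∑ i ∈ Finset.range r, A (i + 2) * A (r - 1 - i) := by
      cases r with
      | zero => simp [hA0]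
      | succ n => rw [hA, Finset.Nat.sum_antidiagonal_eq_sum_range_succ (fun i j => A (i+2) * A j)]; rfl
    have hs : (((List.range r).map (fun i => (i + 2) :: (r - 1 - i) :: s)).map
        fun t => (t.map A).prod).sum
        = (∑ i ∈ Finset.range r, A (i + 2) * A (r - 1 - i)) * (s.map A).prod := by
      rw [List.map_map, ← List.sum_toFinset _ List.nodup_range, List.toFinset_range,
        Finset.sum_mul]
      exact Finset.sum_congr rfl fun i _ => by simp [mul_assoc]
    rw [List.map_cons, List.prod_cons, stackMoves, List.map_append, List.sum_append, hs]
    linear_combination (s.map A).prod * hr + ih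

theorem sum_stackSucc (hA0 : A 0 = 1) (hc : c = 1 + X * c * A 1)
    (hA : ∀ n, A (n+1) = 1 + X * c * ∑ p ∈ Finset.HasAntidiagonal.antidiagonal n,
      A (p.1 + 2) * A p.2) (s : List ℕ) :
    c * (s.map A).prod = 1 + X * ((stackSucc s).map fun t => c * (t.map A).prod).sum := by
  have h := sum_stackMoves hA0 hA s
  rw [stackSucc, List.map_cons, List.sum_cons, List.sum_map_mul_left, List.map_cons,
    List.prod_cons]
  linear_combination h + (s.map A).prod * hc

theorem weight_expansion (hA0 : A 0 = 1) (hc : c = 1 + X * c * A 1)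
    (hA : ∀ n, A (n+1) = 1 + X * c * ∑ p ∈ Finset.HasAntidiagonal.antidiagonal n,
      A (p.1 + 2) * A p.2) (n : ℕ) :
    c = ∑ k ∈ Finset.range n, ((stackLevel k).length : ℝ⟦X⟧) * X ^ k
      + X ^ n * ((stackLevel n).map fun t => c * (t.map A).prod).sum := by
  induction n with
  | zero => simp [stackLevel]
  | succ n ih =>
    have h : ∀ L : List (List ℕ), (L.map fun t => c * (t.map A).prod).sum = (L.length : ℝ⟦X⟧) +
        X * ((L.flatMap stackSucc).map fun t => c * (t.map A).prod).sum := by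
      intro L
      induction L with
      | nil => simp
      | cons s L ih =>
        rw [List.map_cons, List.sum_cons, ih, sum_stackSucc hA0 hc hA s, List.flatMap_cons,
          List.map_append, List.sum_append, List.length_cons]
        push_cast
        ring
    rw [Finset.sum_range_succ, stackLevel]
    linear_combination ih + X ^ n * h (stackLevel n)

theorem coeff_weight (hA0 : A 0 = 1) (hc : c = 1 + X * c * A 1)
    (hA : ∀ n, A (n+1) = 1 + X * c * ∑ p ∈ Finset.HasAntidiagonal.antidiagonal n,
      A (p.1 + 2) * A p.2) (n : ℕ) :
    coeff n c = (stackLevel n).length := by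
  rw [weight_expansion hA0 hc hA (n + 1), map_add, pow_succ, mul_assoc, coeff_X_pow_mul',
    if_pos le_rfl, Nat.sub_self]
  rw [map_sum, Finset.sum_range_succ, Finset.sum_eq_zero]
  · rw [← map_natCast (C (R := ℝ)), coeff_C_mul, coeff_X_pow_self]
    simp
  · intro k hk
    rw [← map_natCast (C (R := ℝ)), coeff_C_mul, coeff_X_pow, if_neg, mul_zero]
    exact (Finset.mem_range.1 hk).ne'

end Weights

theorem exists_stackLevel_series : ∃ c : ℝ⟦X⟧, (∀ n, coeff n c = (stackLevel n).length) ∧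
    c * (1 - catU) ^ 3 = 1 - 2 * catU := by
  obtain ⟨c, A, hA0, hc, hA, h⟩ := exists_weights
  exact ⟨c, coeff_weight hA0 hc hA, h⟩

/-- Partial sums of a power series at `1/8`. -/
noncomputable def partialEval (N : ℕ) (f : ℝ⟦X⟧) : ℝ :=
  ∑ n ∈ Finset.range N, coeff n f * (1 / 8) ^ n

theorem partialEval_mul_le {f g : ℝ⟦X⟧} (hf : ∀ n, 0 ≤ coeff n f) (hg : ∀ n, 0 ≤ coeff n g)
    (N : ℕ) : partialEval N (f * g) ≤ partialEval N f * partialEval N g := by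
  unfold partialEval
  rw [Finset.sum_mul_sum, ← Finset.sum_product']
  have h1 : ∀ n, coeff n (f * g) * (1 / 8) ^ n =
      ∑ p ∈ Finset.HasAntidiagonal.antidiagonal n,
        (coeff p.1 f * (1 / 8) ^ p.1) * (coeff p.2 g * (1 / 8) ^ p.2) := by
    intro n
    rw [coeff_mul, Finset.sum_mul]
    refine Finset.sum_congr rfl fun p hp => ?_
    rw [← Finset.HasAntidiagonal.mem_antidiagonal.1 hp, pow_add]
    ring
  simp_rw [h1]
  rw [← Finset.sum_biUnion]
  · refine Finset.sum_le_sum_of_subset_of_nonneg (fun p hp => ?_) fun p _ _ =>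
      mul_nonneg (mul_nonneg (hf _) (by positivity)) (mul_nonneg (hg _) (by positivity))
    obtain ⟨n, hn, hp⟩ := Finset.mem_biUnion.1 hp
    have := Finset.HasAntidiagonal.mem_antidiagonal.1 hp
    have := Finset.mem_range.1 hn
    exact Finset.mem_product.2 ⟨Finset.mem_range.2 (by omega), Finset.mem_range.2 (by omega)⟩
  · intro a _ b _ hab
    refine Finset.disjoint_left.2 fun p hp hp' => hab ?_
    rw [← Finset.HasAntidiagonal.mem_antidiagonal.1 hp,
      Finset.HasAntidiagonal.mem_antidiagonal.1 hp']

theorem partialEval_one_add_X_mul (f : ℝ⟦X⟧) (N : ℕ) :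
    partialEval (N + 1) (1 + X * f) = 1 + 1 / 8 * partialEval N f := by
  unfold partialEval
  rw [Finset.sum_range_succ', add_comm, Finset.mul_sum]
  congr 1
  · simp
  · refine Finset.sum_congr rfl fun n _ => ?_
    rw [map_add, coeff_succ_X_mul, coeff_one, if_neg (Nat.succ_ne_zero n)]
    ring

theorem coeff_mul_nonneg {f g : ℝ⟦X⟧} (hf : ∀ n, 0 ≤ coeff n f) (hg : ∀ n, 0 ≤ coeff n g)
    (n : ℕ) : 0 ≤ coeff n (f * g) := by
  rw [coeff_mul]
  exact Finset.sum_nonneg fun p _ => mul_nonneg (hf _) (hg _)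

theorem partialEval_nonneg {f : ℝ⟦X⟧} (hf : ∀ n, 0 ≤ coeff n f) (N : ℕ) :
    0 ≤ partialEval N f :=
  Finset.sum_nonneg fun n _ => mul_nonneg (hf n) (by positivity)

theorem length_stackLevel_le (n : ℕ) : ((stackLevel n).length : ℝ) ≤ 3 * 8 ^ n := by
  obtain ⟨c, hc, h⟩ := exists_stackLevel_series
  set Y : ℝ⟦X⟧ := rescale 2 (PowerSeries.map (Nat.castRingHom ℝ) catalanSeries) with hY
  have hUY : catU = X * Y := rfl
  have hYe : Y = 1 + X * (2 * Y ^ 2) := by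
    have := catU_eq
    rw [hUY] at this
    exact mul_left_cancel₀ X_ne_zero (by linear_combination this)
  have hY0 : ∀ n, 0 ≤ coeff n Y := by
    intro n
    simp only [hY, coeff_rescale, coeff_map, catalanSeries_coeff, eq_natCast]
    positivity
  have hU0 : constantCoeff catU = 0 := by simpa using coeff_zero_catU
  have hUn : ∀ n, 0 ≤ coeff n catU := by
    rintro (_ | n)
    · exact coeff_zero_catU.ge
    · rw [coeff_succ_catU]; positivity
  obtain ⟨V, hV⟩ : ∃ V, (1 - catU) * V = 1 :=
    ⟨(1 - catU)⁻¹, PowerSeries.mul_inv_cancel _ (by simp [hU0])⟩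
  have hVe : V = 1 + X * (Y * V) := by rw [hUY] at hV; linear_combination hV
  have hV0 : ∀ n, 0 ≤ coeff n V := by
    intro n
    induction n using Nat.strong_induction_on with
    | _ n ih =>
      rw [hVe]
      cases n with
      | zero => simp
      | succ n =>
        rw [map_add, coeff_succ_X_mul, coeff_one, if_neg (Nat.succ_ne_zero n), zero_add, coeff_mul]
        refine Finset.sum_nonneg fun p hp => mul_nonneg (hY0 _) (ih _ ?_)
        have := Finset.HasAntidiagonal.mem_antidiagonal.1 hp
        omega
  have hYb : ∀ N, partialEval N Y ≤ 2 := by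
    intro N
    induction N with
    | zero => simp [partialEval]
    | succ N ih =>
      rw [hYe, partialEval_one_add_X_mul]
      have h1 := partialEval_mul_le hY0 hY0 N
      have h2 := partialEval_nonneg hY0 N
      have h3 : partialEval N (2 * Y ^ 2) = 2 * partialEval N (Y * Y) := by
        unfold partialEval
        rw [Finset.mul_sum]
        refine Finset.sum_congr rfl fun n _ => ?_
        rw [← map_ofNat (C (R := ℝ)), coeff_C_mul, sq]
        ring
      rw [h3]
      nlinarith
  have hVb : ∀ N, partialEval N V ≤ 4 / 3 := by
    intro N
    induction N with
    | zero => norm_num [partialEval]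
    | succ N ih =>
      rw [hVe, partialEval_one_add_X_mul]
      have h1 := partialEval_mul_le hY0 hV0 N
      have h2 := partialEval_nonneg hY0 N
      have h3 := partialEval_nonneg hV0 N
      nlinarith [hYb N]
  have hcV : c + catU * V ^ 3 + catU * V ^ 3 = V * V * V := by
    have : (1 - catU) ^ 3 * V ^ 3 = 1 := by rw [← mul_pow, hV, one_pow]
    linear_combination V ^ 3 * h - c * this
  have hle : coeff n c ≤ coeff n (V * V * V) := by
    rw [← hcV, map_add, map_add]
    have : 0 ≤ coeff n (catU * V ^ 3) := by
      refine coeff_mul_nonneg hUn ?_ n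
      rw [pow_succ, sq]
      exact coeff_mul_nonneg (coeff_mul_nonneg hV0 hV0) hV0
    linarith
  have h4 : partialEval (n + 1) (V * V * V) ≤ 3 := by
    have h1 := partialEval_mul_le (coeff_mul_nonneg hV0 hV0) hV0 (n + 1)
    have h2 := partialEval_mul_le hV0 hV0 (n + 1)
    have h3 := partialEval_nonneg hV0 (n + 1)
    have h5 := partialEval_nonneg (coeff_mul_nonneg hV0 hV0) (n + 1)
    have := hVb (n + 1)
    nlinarith
  have h5 : coeff n (V * V * V) * (1 / 8) ^ n ≤ partialEval (n + 1) (V * V * V) := by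
    refine Finset.single_le_sum (f := fun n => coeff n (V * V * V) * (1 / 8 : ℝ) ^ n)
      (fun k _ => mul_nonneg ?_ (by positivity)) (Finset.self_mem_range_succ n)
    exact coeff_mul_nonneg (coeff_mul_nonneg hV0 hV0) hV0 k
  rw [← hc]
  have h6 : coeff n c * (1 / 8) ^ n ≤ 3 :=
    (mul_le_mul_of_nonneg_right hle (by positivity)).trans (h5.trans h4)
  rw [one_div, inv_pow, ← div_eq_mul_inv, div_le_iff₀ (by positivity)] at h6
  exact h6

theorem pow_le_length_stackLevel (n : ℕ) :
    (8 : ℝ) ^ n ≤ 16 * (n + 1) ^ 3 * (stackLevel n).length := by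
  obtain ⟨c, hc, h⟩ := exists_stackLevel_series
  have hU0 : constantCoeff catU = 0 := by simpa using coeff_zero_catU
  obtain ⟨α, hα⟩ : ∃ α, (1 - 2 * catU) * α = 1 :=
    ⟨(1 - 2 * catU)⁻¹, PowerSeries.mul_inv_cancel _ (by simp [hU0])⟩
  obtain ⟨F, hF⟩ : ∃ F, F = (catU - 3 * catU ^ 2 + catU ^ 3) * α := ⟨_, rfl⟩
  have hX : X = catU - 2 * catU ^ 2 := by linear_combination -catU_eq
  have hcF : c = 1 + c * F := by
    have : c * (1 - catU) ^ 3 * α = 1 := by rw [h, hα]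
    rw [hF]
    linear_combination (-c) * hα + this
  have h8 : X * (C 8 * F) = X * (C 2 * X + 1 + C 8 * catU) - catU := by
    rw [show (C (8:ℝ) : ℝ⟦X⟧) = 8 from map_ofNat C 8, show (C (2:ℝ) : ℝ⟦X⟧) = 2 from map_ofNat C 2,
      hF, hX]
    linear_combination 8 * catU * (catU - 3 * catU ^ 2 + catU ^ 3) * hα
  have hcat : ∀ n : ℕ, ((n:ℝ) + 2) * catalan (n + 1) = (4 * n + 2) * catalan n := by
    intro n
    have h1 := succ_mul_catalan_eq_centralBinom n
    have h2 := succ_mul_catalan_eq_centralBinom (n + 1)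
    have h3 := Nat.succ_mul_centralBinom_succ n
    rw [← h1, ← h2] at h3
    have h4 : ((n:ℝ) + 1) * (((n:ℝ) + 2) * catalan (n + 1)) = ((n:ℝ) + 1) * ((4 * n + 2) * catalan n) := by
      have := congrArg (Nat.cast (R := ℝ)) h3
      push_cast at this
      linear_combination this
    exact mul_left_cancel₀ (by positivity) h4
  have hFm : ∀ m, 1 ≤ m → coeff (m + 1) F = 2 ^ m * catalan m * (3 / (2 * (m + 2))) := by
    intro m hm
    obtain ⟨k, rfl⟩ : ∃ k, m = k + 1 := ⟨m - 1, by omega⟩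
    have := congrArg (coeff (k + 1 + 1 + 1)) h8
    rw [coeff_succ_X_mul, map_sub, coeff_succ_X_mul, coeff_C_mul, map_add, map_add, coeff_C_mul,
      coeff_C_mul, coeff_succ_catU, coeff_succ_catU, coeff_X, coeff_one, if_neg (by omega),
      if_neg (by omega)] at this
    have h5 := hcat (k + 1)
    push_cast at h5 ⊢
    rw [← mul_div_assoc, eq_div_iff (by positivity)]
    linear_combination (((k:ℝ) + 1 + 2) / 4) * this - 2 ^ (k + 2) / 4 * h5
  have hF0 : ∀ n, 0 ≤ coeff n F := by
    rintro (_ | _ | n)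
    · simp [hF, hU0]
    · have := congrArg (coeff (1 + 1)) h8
      rw [coeff_succ_X_mul, map_sub, coeff_succ_X_mul, coeff_C_mul, map_add, map_add, coeff_C_mul,
        coeff_C_mul, coeff_succ_catU, coeff_X, coeff_one] at this
      have hU2 := coeff_succ_catU 1
      norm_num at this hU2
      rw [hU2] at this
      simp only [zero_add]
      linarith
    · rw [hFm (n + 1) (by omega)]
      positivity
  have hcF' : ∀ n, 1 ≤ n → coeff n F ≤ coeff n c := by
    intro n hn
    have h0 : coeff n c = coeff n (c * F) := by
      conv_lhs => rw [hcF]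
      rw [map_add, coeff_one, if_neg (by omega), zero_add]
    rw [h0, coeff_mul]
    have h1 : coeff n F = coeff 0 c * coeff n F := by
      rw [hc]; simp [stackLevel]
    nth_rw 1 [h1]
    refine Finset.single_le_sum (f := fun p : ℕ × ℕ => coeff p.1 c * coeff p.2 F)
      (fun p _ => mul_nonneg ?_ (hF0 _)) (a := (0, n)) (by simp)
    rw [hc]; positivity
  obtain _ | _ | n := n
  · norm_num [stackLevel]
  · norm_num [stackLevel, stackSucc, stackMoves]
  rw [← hc]
  have h1 := hcF' (n + 2) (by omega)
  rw [hFm (n + 1) (by omega)] at h1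
  have h2 : (4 : ℝ) ^ (n + 1) ≤ 2 * (n + 1) * ((n + 2) * catalan (n + 1)) := by
    have h3 := Nat.four_pow_le_two_mul_self_mul_centralBinom (n + 1) (by omega)
    rw [← succ_mul_catalan_eq_centralBinom] at h3
    have h4 : ((4 ^ (n + 1) : ℕ) : ℝ) ≤ _ := Nat.cast_le.2 h3
    push_cast at h4
    linarith
  have h8' : (8 : ℝ) ^ (n + 2) = 8 * (2 ^ (n + 1) * 4 ^ (n + 1)) := by
    rw [← mul_pow]; norm_num; ring
  have hcat0 : (0 : ℝ) ≤ catalan (n + 1) := by positivity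
  calc (8 : ℝ) ^ (n + 2) = 8 * (2 ^ (n + 1) * 4 ^ (n + 1)) := h8'
    _ ≤ 8 * (2 ^ (n + 1) * (2 * (n + 1) * ((n + 2) * catalan (n + 1)))) := by gcongr
    _ ≤ 24 * (2 ^ (n + 1) * ((n + 3) ^ 2 * catalan (n + 1))) := by
      have : (8 : ℝ) * (2 * (n + 1) * (n + 2)) ≤ 24 * (n + 3) ^ 2 := by
        have : (0 : ℝ) ≤ n := by positivity
        nlinarith
      nlinarith [mul_le_mul_of_nonneg_right this
        (mul_nonneg (pow_nonneg (zero_le_two (α := ℝ)) (n + 1)) hcat0)]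
    _ = 16 * ((n + 2 : ℕ) + 1 : ℝ) ^ 3 *
        (2 ^ (n + 1) * catalan (n + 1) * (3 / (2 * ((n + 1 : ℕ) + 2)))) := by
      push_cast
      field_simp
      ring
    _ ≤ _ := by gcongr

end PowerSeries

/-- The word `v` has a subword order isomorphic to `213`. -/
def Contains213 (v : List ℕ) : Prop :=
  ∃ a b c, a < b ∧ b < c ∧ [b, a, c].Sublist v

/-- The word `v` has a subword order isomorphic to `4213`. -/
def Contains4213 (v : List ℕ) : Prop :=
  ∃ a b c d, a < b ∧ b < c ∧ c < d ∧ [d, b, a, c].Sublist v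

theorem Contains213.mono {v w : List ℕ} (h : Contains213 v) (hvw : v.Sublist w) :
    Contains213 w := by
  obtain ⟨a, b, c, h1, h2, h3⟩ := h
  exact ⟨a, b, c, h1, h2, h3.trans hvw⟩

theorem Contains4213.mono {v w : List ℕ} (h : Contains4213 v) (hvw : v.Sublist w) :
    Contains4213 w := by
  obtain ⟨a, b, c, d, h1, h2, h3, h4⟩ := h
  exact ⟨a, b, c, d, h1, h2, h3, h4.trans hvw⟩

/-- A sublist of a word with a new letter `t` either avoids `t` or uses it. -/
theorem sublist_insert_cases {l x y : List ℕ} {t : ℕ} (h : l.Sublist (x ++ t :: y)) :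
    l.Sublist (x ++ y) ∨
      ∃ l₁ l₂, l = l₁ ++ t :: l₂ ∧ l₁.Sublist x ∧ l₂.Sublist y := by
  obtain ⟨l₁, l₂, rfl, h1, h2⟩ := List.sublist_append_iff.1 h
  rcases List.sublist_cons_iff.1 h2 with h2 | ⟨r, rfl, h3⟩
  · exact Or.inl (h1.append h2)
  · exact Or.inr ⟨l₁, r, rfl, h1, h3⟩

theorem contains4213_insert_max {x y : List ℕ} {t : ℕ} (hlt : ∀ z ∈ x ++ y, z < t)
    (hv : ¬ Contains4213 (x ++ y)) : Contains4213 (x ++ t :: y) ↔ Contains213 y := by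
  constructor
  · rintro ⟨a, b, c, d, hab, hbc, hcd, hs⟩
    rcases sublist_insert_cases hs with hs | ⟨l₁, l₂, h, h1, h2⟩
    · exact absurd ⟨a, b, c, d, hab, hbc, hcd, hs⟩ hv
    · rcases l₁ with _ | ⟨d', l₁⟩
      · simp only [List.nil_append, List.cons.injEq] at h
        obtain ⟨-, rfl⟩ := h
        exact ⟨a, b, c, hab, hbc, h2⟩
      · simp only [List.cons_append, List.cons.injEq] at h
        obtain ⟨rfl, h⟩ := h
        have hd := hlt d (List.mem_append_left _ (h1.subset List.mem_cons_self))
        have ht : t ∈ [b, a, c] := by rw [h]; simp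
        simp at ht
        omega
  · rintro ⟨a, b, c, hab, hbc, hs⟩
    refine ⟨a, b, c, t, hab, hbc, hlt c ?_, ?_⟩
    · exact List.mem_append_right _ (hs.subset (by simp))
    · exact (hs.cons_cons t).trans (List.sublist_append_right _ _)

/-- The insertions of `t` into a word, other than the one at the very front. -/
def laterInsertions (t : ℕ) : List ℕ → List (List ℕ)
  | [] => []
  | y :: ys => (List.permutations'Aux t ys).map (y :: ·)

theorem permutationsAux_eq_cons (t : ℕ) (w : List ℕ) :
    List.permutations'Aux t w = (t :: w) :: laterInsertions t w := by
  cases w <;> rfl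

theorem laterInsertions_append (t : ℕ) (b w : List ℕ) :
    laterInsertions t (b ++ w) =
      (List.range b.length).map (fun i => b.take (i + 1) ++ t :: (b.drop (i + 1) ++ w)) ++
        (laterInsertions t w).map (b ++ ·) := by
  induction b with
  | nil => simp
  | cons y b ih =>
    rw [List.cons_append, laterInsertions, permutationsAux_eq_cons, ih, List.length_cons,
      List.range_succ_eq_map]
    simp [Function.comp_def]

theorem mem_permutationsAux {t : ℕ} {w z : List ℕ} (h : z ∈ List.permutations'Aux t w) :
    ∃ x y, w = x ++ y ∧ z = x ++ t :: y := by
  induction w generalizing z with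
  | nil => exact ⟨[], [], rfl, by simpa using h⟩
  | cons a w ih =>
    rcases List.mem_cons.1 (by simpa only [List.permutations'Aux] using h) with rfl | h
    · exact ⟨[], a :: w, rfl, rfl⟩
    · obtain ⟨z, hz, rfl⟩ := List.mem_map.1 h
      obtain ⟨x, y, rfl, rfl⟩ := ih hz
      exact ⟨a :: x, y, rfl, rfl⟩

theorem permutationsAux_append (t : ℕ) (x y : List ℕ) :
    ∃ l, List.permutations'Aux t (x ++ y) = l ++ (List.permutations'Aux t y).map (x ++ ·) ∧
      ∀ z ∈ l, ∃ x₁ x₂, x₂ ≠ [] ∧ x = x₁ ++ x₂ ∧ z = x₁ ++ t :: (x₂ ++ y) := by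
  induction x with
  | nil => exact ⟨[], by simp⟩
  | cons a x ih =>
    obtain ⟨l, hl, h⟩ := ih
    refine ⟨(t :: a :: (x ++ y)) :: l.map (a :: ·), ?_, ?_⟩
    · simp [List.permutations'Aux, hl, Function.comp_def]
    · intro z hz
      rcases List.mem_cons.1 hz with rfl | hz
      · exact ⟨[], a :: x, by simp⟩
      · obtain ⟨z, hz', rfl⟩ := List.mem_map.1 hz
        obtain ⟨x₁, x₂, h1, rfl, rfl⟩ := h z hz'
        exact ⟨a :: x₁, x₂, h1, rfl, rfl⟩

/-- A list of ascending words, where each descends at the junction to what follows it. -/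
def GoodBlocks : List (List ℕ) → Prop
  | [] => True
  | b :: bs => b.Pairwise (· < ·) ∧
      (∀ x ∈ b.getLast?, ∀ y ∈ bs.flatten.head?, y < x) ∧ GoodBlocks bs

/-- The word `v`, with letters below `t`, avoids `4213`, and its longest `213`-avoiding suffix
has been cut into ascending words of lengths `s`. -/
def HasStack (t : ℕ) (v : List ℕ) (s : List ℕ) : Prop :=
  (∀ x ∈ v, x < t) ∧ ¬ Contains4213 v ∧
    ∃ (u : List ℕ) (bs : List (List ℕ)), v = u ++ bs.flatten ∧ s = bs.map List.length ∧
      GoodBlocks bs ∧ ¬ Contains213 bs.flatten ∧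
      ∀ x ∈ u.getLast?, Contains213 (x :: bs.flatten)

theorem not_contains213_insert_max {x y : List ℕ} {t : ℕ} (hlt : ∀ z ∈ x ++ y, z < t)
    (hx : x.Pairwise (· < ·)) (h : ¬ Contains213 (x ++ y)) : ¬ Contains213 (x ++ t :: y) := by
  rintro ⟨a, b, c, hab, hbc, hs⟩
  rcases sublist_insert_cases hs with hs | ⟨l₁, l₂, e, h1, h2⟩
  · exact h ⟨a, b, c, hab, hbc, hs⟩
  · have hy : ∀ z ∈ l₂, z < t := fun z hz => hlt z (List.mem_append_right _ (h2.subset hz))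
    obtain _ | ⟨b', _ | ⟨a', l₁⟩⟩ := l₁
    · simp only [List.nil_append, List.cons.injEq] at e
      obtain ⟨rfl, rfl⟩ := e
      have := hy c (by simp)
      omega
    · simp only [List.cons_append, List.nil_append, List.cons.injEq] at e
      obtain ⟨rfl, rfl, rfl⟩ := e
      have := hy c (by simp)
      omega
    · simp only [List.cons_append, List.cons.injEq] at e
      obtain ⟨rfl, rfl, e⟩ := e
      have h3 : [b, a].Sublist x := (List.Sublist.cons_cons b
        (List.Sublist.cons_cons a (List.nil_sublist _))).trans h1
      have := hx.sublist h3
      simp at this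
      omega

theorem insert_lt_succ {x y : List ℕ} {t : ℕ} (hlt : ∀ z ∈ x ++ y, z < t) :
    ∀ z ∈ x ++ t :: y, z < t + 1 := by
  intro z hz
  simp only [List.mem_append, List.mem_cons] at hz hlt
  rcases hz with hz | rfl | hz
  · exact (hlt z (Or.inl hz)).trans (Nat.lt_succ_self t)
  · exact Nat.lt_succ_self z
  · exact (hlt z (Or.inr hz)).trans (Nat.lt_succ_self t)

theorem hasStack_laterInsertions {t : ℕ} (bs : List (List ℕ)) (u : List ℕ)
    (hbs : GoodBlocks bs) (h213 : ¬ Contains213 bs.flatten) (hlt : ∀ x ∈ u ++ bs.flatten, x < t)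
    (h4213 : ¬ Contains4213 (u ++ bs.flatten))
    (hu : ∀ x ∈ u.getLast?, Contains213 (x :: bs.flatten) ∨ ∀ y ∈ bs.flatten.head?, y < x) :
    List.Forall₂ (HasStack (t + 1)) ((laterInsertions t bs.flatten).map (u ++ ·))
      (stackMoves (bs.map List.length)) := by
  induction bs generalizing u with
  | nil => simp [laterInsertions, stackMoves]
  | cons b bs ih =>
    obtain ⟨hb, hj, hbs⟩ := hbs
    rw [List.flatten_cons, laterInsertions_append, List.map_append, List.map_cons, stackMoves]
    rw [List.flatten_cons] at h213 hlt h4213 hu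
    refine List.rel_append ?_ ?_
    · rw [List.map_map, List.forall₂_map_left_iff, List.forall₂_map_right_iff, List.forall₂_same]
      intro i hi
      rw [List.mem_range] at hi
      have hsplit : b.take (i + 1) ++ (b.drop (i + 1) ++ bs.flatten) = b ++ bs.flatten := by
        rw [← List.append_assoc, List.take_append_drop]
      have hlt' : ∀ z ∈ (u ++ b.take (i + 1)) ++ (b.drop (i + 1) ++ bs.flatten), z < t := by
        rwa [List.append_assoc, hsplit]
      have htl : ∀ z ∈ b.take (i + 1) ++ (b.drop (i + 1) ++ bs.flatten), z < t := by
        rw [hsplit]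
        exact fun z hz => hlt z (List.mem_append_right _ hz)
      have hins : ∀ x, Contains213 (x :: (b ++ bs.flatten)) →
          Contains213 (x :: (b.take (i + 1) ++ t :: (b.drop (i + 1) ++ bs.flatten))) := by
        intro x hx
        refine hx.mono (List.Sublist.cons_cons x ?_)
        rw [← hsplit]
        exact (List.Sublist.refl _).append (List.sublist_cons_self _ _)
      refine ⟨?_, ?_, u, (b.take (i + 1) ++ [t]) :: b.drop (i + 1) :: bs, ?_, ?_, ?_, ?_, ?_⟩
      · have := insert_lt_succ hlt'
        simpa only [Function.comp, List.append_assoc] using this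
      · have := (contains4213_insert_max hlt' (by rwa [List.append_assoc, hsplit])).not.2
          (fun h => h213 (h.mono (by rw [← hsplit]; exact List.sublist_append_right _ _)))
        simpa only [Function.comp, List.append_assoc] using this
      · simp
      · simp only [List.map_cons, List.length_append, List.length_take, List.length_drop,
          List.length_cons, List.length_nil, List.cons.injEq, and_true]
        omega
      · refine ⟨?_, ?_, hb.sublist (List.drop_sublist _ _), ?_, hbs⟩
        · rw [List.pairwise_append]
          refine ⟨hb.sublist (List.take_sublist _ _), by simp, ?_⟩
          intro z hz y hy
          rw [List.mem_singleton.1 hy]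
          exact htl z (List.mem_append_left _ hz)
        · intro x hx y hy
          simp only [List.getLast?_concat, Option.mem_def, Option.some.injEq] at hx
          subst hx
          have hy := List.mem_of_mem_head? hy
          rw [List.flatten_cons] at hy
          exact htl y (List.mem_append_right _ hy)
        · intro x hx y hy
          refine hj x ?_ y hy
          rw [List.getLast?_drop] at hx
          split_ifs at hx
          · simp at hx
          · exact hx
      · simpa using not_contains213_insert_max htl (hb.sublist (List.take_sublist _ _))
          (by rwa [hsplit])
      · intro x hx
        have e : ((b.take (i + 1) ++ [t]) :: b.drop (i + 1) :: bs).flatten =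
          b.take (i + 1) ++ t :: (b.drop (i + 1) ++ bs.flatten) := by simp
        rw [e]
        rcases hu x hx with h | h
        · exact hins x h
        · obtain _ | ⟨y, b⟩ := b
          · simp at hi
          · refine ⟨y, x, t, h y (by simp), hlt x ?_, ?_⟩
            · exact List.mem_append_left _ (List.mem_of_mem_getLast? hx)
            · simp
    · rw [List.map_map]
      have := ih (u ++ b) hbs (fun h => h213 (h.mono (List.sublist_append_right _ _)))
        (by rwa [List.append_assoc]) (by rwa [List.append_assoc]) ?_
      · simpa only [Function.comp_def, List.append_assoc] using this
      · intro x hx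
        rcases List.eq_nil_or_concat b with rfl | ⟨b', z, rfl⟩
        · simpa using hu x (by simpa using hx)
        · right
          apply hj
          simpa [← List.append_assoc] using hx

open Classical in
theorem HasStack.forall₂_insertions {t : ℕ} {v s : List ℕ} (h : HasStack t v s) :
    List.Forall₂ (HasStack (t + 1))
      ((List.permutations'Aux t v).filter (fun w => ¬ Contains4213 w)) (stackSucc s) := by
  obtain ⟨hlt, h4213, u, bs, rfl, rfl, hbs, h213, hu⟩ := h
  obtain ⟨l, hl, hl'⟩ := permutationsAux_append t u bs.flatten
  have hfl : l.filter (fun w => ¬ Contains4213 w) = [] := by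
    rw [List.filter_eq_nil_iff]
    intro z hz
    obtain ⟨x₁, x₂, hne, rfl, rfl⟩ := hl' z hz
    rw [List.append_assoc] at hlt h4213
    simp only [decide_not, Bool.not_eq_eq_eq_not, Bool.not_true, decide_eq_false_iff_not, not_not]
    rw [contains4213_insert_max hlt h4213]
    have hx := hu (x₂.getLast hne) (by
      rw [List.getLast?_append, List.getLast?_eq_getLast_of_ne_nil hne]; simp)
    refine hx.mono ?_
    conv_rhs => rw [← List.dropLast_append_getLast hne, List.append_assoc]
    exact List.sublist_append_right _ _
  have hfr : ((List.permutations'Aux t bs.flatten).map (u ++ ·)).filter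
      (fun w => ¬ Contains4213 w) = (List.permutations'Aux t bs.flatten).map (u ++ ·) := by
    rw [List.filter_eq_self]
    intro z hz
    obtain ⟨z, hz', rfl⟩ := List.mem_map.1 hz
    obtain ⟨x, y, e, rfl⟩ := mem_permutationsAux hz'
    rw [e, ← List.append_assoc] at hlt h4213
    rw [decide_eq_true_eq, ← List.append_assoc, contains4213_insert_max hlt h4213]
    exact fun h => h213 (h.mono (e ▸ List.sublist_append_right _ _))
  rw [hl, List.filter_append, hfl, hfr, List.nil_append, permutationsAux_eq_cons, List.map_cons,
    stackSucc]
  refine List.Forall₂.cons ?_ (hasStack_laterInsertions bs u hbs h213 hlt h4213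
    fun x hx => Or.inl (hu x hx))
  refine ⟨insert_lt_succ hlt, (contains4213_insert_max hlt h4213).not.2 h213, u, [t] :: bs,
    by simp, by simp, ⟨by simp, ?_, hbs⟩, ?_, ?_⟩
  · intro x hx y hy
    simp only [List.getLast?_singleton, Option.mem_def, Option.some.injEq] at hx
    subst hx
    exact hlt y (List.mem_append_right _ (List.mem_of_mem_head? hy))
  · exact not_contains213_insert_max (x := [])
      (fun z hz => hlt z (List.mem_append_right _ hz)) (by simp) h213
  · intro x hx
    exact (hu x hx).mono (List.Sublist.cons_cons x (List.sublist_cons_self _ _))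

/-- The word `n - 1, …, 1, 0`. -/
def descWord : ℕ → List ℕ
  | 0 => []
  | n + 1 => n :: descWord n

open Classical in
theorem forall₂_hasStack_stackLevel (n : ℕ) :
    List.Forall₂ (HasStack n)
      ((descWord n).permutations'.filter (fun w => ¬ Contains4213 w)) (stackLevel n) := by
  induction n with
  | zero =>
    have h : ¬ Contains4213 [] := by rintro ⟨a, b, c, d, -, -, -, h⟩; simp at h
    have h' : ¬ Contains213 [] := by rintro ⟨a, b, c, -, -, h⟩; simp at h
    simp only [descWord, List.permutations', stackLevel, List.filter_cons, h, not_false_eq_true,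
      decide_true, if_true, List.filter_nil, List.forall₂_cons, List.Forall₂.nil, and_true]
    exact ⟨by simp, h, [], [], rfl, rfl, trivial, h', by simp⟩
  | succ n ih =>
    have e : (descWord (n + 1)).permutations'.filter (fun w => ¬ Contains4213 w) =
        ((descWord n).permutations'.filter (fun w => ¬ Contains4213 w)).flatMap
          (fun v => (List.permutations'Aux n v).filter (fun w => ¬ Contains4213 w)) := by
      rw [descWord, List.permutations', List.filter_flatMap]
      induction (descWord n).permutations' with
      | nil => rfl
      | cons v l ih =>
        rw [List.flatMap_cons, ih, List.filter_cons]
        split_ifs with h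
        · rfl
        · simp only [decide_eq_true_eq, not_not] at h
          rw [List.filter_eq_nil_iff.2, List.nil_append]
          intro z hz
          obtain ⟨x, y, rfl, rfl⟩ := mem_permutationsAux hz
          simpa using h.mono ((List.Sublist.refl x).append (List.sublist_cons_self _ _))
    rw [e]
    exact List.rel_flatMap ih fun v s h => h.forall₂_insertions

open Classical in
theorem length_filter_permutations (n : ℕ) :
    ((descWord n).permutations'.filter (fun w => ¬ Contains4213 w)).length =
      (stackLevel n).length :=
  (forall₂_hasStack_stackLevel n).length_eq

/-- The map `f` between ordered sets has a pattern `4213`. -/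
def Has4213 {α β : Type*} [LT α] [LT β] (f : α → β) : Prop :=
  ∃ i j k l, i < j ∧ j < k ∧ k < l ∧ f k < f j ∧ f j < f l ∧ f l < f i

theorem contains4213_ofFn {n : ℕ} (f : Fin n → Fin n) :
    Contains4213 (List.ofFn fun i => (f i : ℕ)) ↔ Has4213 f := by
  constructor
  · rintro ⟨a, b, c, d, hab, hbc, hcd, hs⟩
    obtain ⟨g, hg⟩ := List.sublist_iff_exists_fin_orderEmbedding_get_eq.1 hs
    have h0 := hg ⟨0, by simp⟩
    have h1 := hg ⟨1, by simp⟩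
    have h2 := hg ⟨2, by simp⟩
    have h3 := hg ⟨3, by simp⟩
    have m : ∀ x y, x < y → (g x).cast (List.length_ofFn) < (g y).cast (List.length_ofFn) :=
      fun x y h => g.strictMono h
    simp only [List.get_ofFn] at h0 h1 h2 h3
    refine ⟨_, _, _, _, m ⟨0, by simp⟩ ⟨1, by simp⟩ ?_, m ⟨1, by simp⟩ ⟨2, by simp⟩ ?_,
      m ⟨2, by simp⟩ ⟨3, by simp⟩ ?_, ?_, ?_, ?_⟩
    · simp
    · simp
    · simp [Fin.lt_def]
    · rw [Fin.lt_def, ← h1, ← h2]; simpa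
    · rw [Fin.lt_def, ← h1, ← h3]; simpa
    · rw [Fin.lt_def, ← h0, ← h3]; simpa
  · rintro ⟨i, j, k, l, hij, hjk, hkl, h1, h2, h3⟩
    refine ⟨f k, f j, f l, f i, h1, h2, h3, ?_⟩
    rw [List.sublist_iff_exists_fin_orderEmbedding_get_eq]
    have hm : StrictMono ![i, j, k, l] := by
      rw [Fin.strictMono_iff_lt_succ]
      intro x
      fin_cases x
      · exact hij
      · exact hjk
      · exact hkl
    refine ⟨OrderEmbedding.ofStrictMono
      (fun x : Fin 4 => (![i, j, k, l] x).cast List.length_ofFn.symm) fun x y h => hm h, ?_⟩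
    intro x
    simp only [List.get_ofFn]
    change Fin 4 at x
    fin_cases x <;> rfl

theorem mem_descWord {n x : ℕ} : x ∈ descWord n ↔ x < n := by
  induction n with
  | zero => simp [descWord]
  | succ n ih => rw [descWord, List.mem_cons, ih]; omega

theorem length_descWord (n : ℕ) : (descWord n).length = n := by
  induction n with
  | zero => rfl
  | succ n ih => rw [descWord, List.length_cons, ih]

theorem nodup_descWord (n : ℕ) : (descWord n).Nodup := by
  induction n with
  | zero => simp [descWord]
  | succ n ih => simp [descWord, ih, mem_descWord]

theorem ofFn_perm_descWord {n : ℕ} (e : Equiv.Perm (Fin n)) :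
    (List.ofFn fun i => (e i : ℕ)).Perm (descWord n) := by
  rw [List.perm_ext_iff_of_nodup _ (nodup_descWord n)]
  · intro x
    rw [mem_descWord, List.mem_ofFn]
    constructor
    · rintro ⟨i, rfl⟩
      exact (e i).2
    · intro hx
      exact ⟨e.symm ⟨x, hx⟩, by simp⟩
  · rw [List.nodup_ofFn]
    exact Fin.val_injective.comp e.injective

theorem exists_perm_of_perm_descWord {n : ℕ} {v : List ℕ} (h : v.Perm (descWord n)) :
    ∃ e : Equiv.Perm (Fin n), (List.ofFn fun i => (e i : ℕ)) = v := by
  have hl : v.length = n := by rw [h.length_eq, length_descWord]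
  subst hl
  have hlt : ∀ i : Fin v.length, v[i] < v.length := fun i =>
    mem_descWord.1 (h.subset (List.getElem_mem i.2))
  have hnd : v.Nodup := h.nodup_iff.2 (nodup_descWord _)
  have hinj : Function.Injective fun i : Fin v.length => (⟨v[i], hlt i⟩ : Fin v.length) := by
    intro i j hij
    exact Fin.ext ((hnd.getElem_inj_iff).1 (Fin.mk.inj_iff.1 hij))
  exact ⟨Equiv.ofBijective _ (Finite.injective_iff_bijective.1 hinj), by
    simp⟩

theorem card_perm_avoiding_4213 (n : ℕ) :
    Nat.card {e : Equiv.Perm (Fin n) // ¬ Has4213 e} = (stackLevel n).length := by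
  classical
  rw [← length_filter_permutations]
  set l := (descWord n).permutations'.filter (fun w => ¬ Contains4213 w) with hl
  have hnd : l.Nodup := by
    refine List.Nodup.filter _ ?_
    rw [← (List.permutations_perm_permutations' _).nodup_iff, List.nodup_permutations_iff]
    exact nodup_descWord n
  have hmem : ∀ v, v ∈ l ↔ v.Perm (descWord n) ∧ ¬ Contains4213 v := by
    intro v
    rw [hl, List.mem_filter, List.mem_permutations', decide_eq_true_eq]
  rw [← List.toFinset_card_of_nodup hnd]
  refine Nat.card_eq_of_equiv_fin (Equiv.trans (Equiv.ofBijective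
    (β := l.toFinset) (fun e => ⟨List.ofFn fun i => (e.1 i : ℕ), ?_⟩) ⟨?_, ?_⟩)
    l.toFinset.equivFin)
  · rw [List.mem_toFinset, hmem, contains4213_ofFn]
    exact ⟨ofFn_perm_descWord _, e.2⟩
  · intro e e' h
    have h' := List.ofFn_injective (Subtype.mk.inj h)
    exact Subtype.ext (Equiv.ext fun i => Fin.ext (congrFun h' i))
  · rintro ⟨v, hv⟩
    rw [List.mem_toFinset, hmem] at hv
    obtain ⟨e, rfl⟩ := exists_perm_of_perm_descWord hv.1
    exact ⟨⟨e, by simpa [contains4213_ofFn] using hv.2⟩, rfl⟩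

/-- The number of bijections avoiding `4213` depends only on the size of the ordered sets. -/
theorem card_equiv_avoiding_4213 {α β : Type*} [Fintype α] [Fintype β] [LinearOrder α]
    [LinearOrder β] {n : ℕ} (hα : Fintype.card α = n) (hβ : Fintype.card β = n) :
    Nat.card {e : α ≃ β // ¬ Has4213 e} = (stackLevel n).length := by
  rw [← card_perm_avoiding_4213]
  let a : Fin n ≃o α := Fintype.orderIsoFinOfCardEq α hα
  let b : Fin n ≃o β := Fintype.orderIsoFinOfCardEq β hβ
  refine Nat.card_congr (Equiv.subtypeEquiv (Equiv.equivCongr a.symm.toEquiv b.symm.toEquiv) ?_)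
  intro e
  refine not_congr ⟨?_, ?_⟩
  · rintro ⟨i, j, k, l, h⟩
    refine ⟨a.symm i, a.symm j, a.symm k, a.symm l, ?_⟩
    simpa [Equiv.equivCongr] using h
  · rintro ⟨i, j, k, l, h⟩
    refine ⟨a i, a j, a k, a l, ?_⟩
    simpa [Equiv.equivCongr] using h

/-- The map `f` between ordered sets has a pattern `54213`. -/
def Has54213 {α β : Type*} [LT α] [LT β] (f : α → β) : Prop :=
  ∃ h i j k l, h < i ∧ i < j ∧ j < k ∧ k < l ∧ f k < f j ∧ f j < f l ∧ f l < f i ∧ f i < f h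

theorem pattContains_patt31245 {n : ℕ} (π : Equiv.Perm (Fin n)) :
    PattContains patt31245 π ↔ Has54213 (Fin.revPerm.trans π) := by
  constructor
  · rintro ⟨f, hf, hp⟩
    have hr : ∀ x y : Fin 5, x < y → (f y).rev < (f x).rev := fun x y h => Fin.rev_lt_rev.2 (hf h)
    refine ⟨(f 4).rev, (f 3).rev, (f 2).rev, (f 1).rev, (f 0).rev, hr 3 4 (by decide),
      hr 2 3 (by decide), hr 1 2 (by decide), hr 0 1 (by decide), ?_⟩
    simp only [Equiv.trans_apply, Fin.revPerm_apply, Fin.rev_rev, hp]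
    simp [patt31245, Fin.lt_def]
  · rintro ⟨h, i, j, k, l, hi, ij, jk, kl, h1, h2, h3, h4⟩
    have hm : StrictMono ![l.rev, k.rev, j.rev, i.rev, h.rev] := by
      rw [Fin.strictMono_iff_lt_succ]
      intro x
      fin_cases x <;> simpa
    have hv : StrictMono (π ∘ ![l.rev, k.rev, j.rev, i.rev, h.rev] ∘ patt31245.symm) := by
      have e : ∀ x, patt31245.symm x = ![1, 2, 0, 3, 4] x := by
        intro x
        rw [Equiv.symm_apply_eq]
        fin_cases x <;> rfl
      rw [Fin.strictMono_iff_lt_succ]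
      intro x
      simp only [Function.comp, e]
      fin_cases x
      · exact h1
      · exact h2
      · exact h3
      · exact h4
    refine ⟨_, hm, fun a b => ?_⟩
    have := hv.lt_iff_lt (a := patt31245 a) (b := patt31245 b)
    simpa using this

theorem avoidCount_patt31245 (n : ℕ) :
    avoidCount patt31245 n = Nat.card {e : Equiv.Perm (Fin n) // ¬ Has54213 e} := by
  refine Nat.card_congr (Equiv.subtypeEquiv (Equiv.equivCongr Fin.revPerm (Equiv.refl _)) ?_)
  intro π
  rw [pattContains_patt31245]
  rfl

/-- The positions of the left-to-right maxima of `f`. -/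
def ltrMaxima {n : ℕ} (f : Fin n → Fin n) : Finset (Fin n) :=
  {i | ∀ j < i, f j < f i}

theorem card_fixed_ltrMaxima_le {n : ℕ} (P V : Finset (Fin n)) (hc : P.card = V.card) :
    Nat.card {e : Equiv.Perm (Fin n) // ¬ Has54213 e ∧ ltrMaxima e = P ∧
      P.map e.toEmbedding = V} ≤ (stackLevel (n - P.card)).length := by
  rw [← card_equiv_avoiding_4213 (α := {x // x ∉ P}) (β := {x // x ∉ V})
    (by simp [Fintype.card_subtype_compl]) (by simp [Fintype.card_subtype_compl, hc])]
  have hmem : ∀ e : Equiv.Perm (Fin n), P.map e.toEmbedding = V → ∀ a, a ∉ P ↔ e a ∉ V := by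
    rintro e rfl a
    simp
  refine Nat.card_le_card_of_injective (fun e =>
    ⟨e.1.subtypeEquiv (hmem e.1 e.2.2.2), ?_⟩) ?_
  · rintro ⟨⟨i, hiP⟩, j, k, l, hij, hjk, hkl, h1, h2, h3⟩
    have hi : i ∉ ltrMaxima e.1 := by rwa [e.2.2.1]
    simp only [ltrMaxima, Finset.mem_filter, Finset.mem_univ, true_and, not_forall, not_lt] at hi
    obtain ⟨h, hhi, hle⟩ := hi
    exact e.2.1 ⟨h, i, j, k, l, hhi, hij, hjk, hkl, h1, h2, h3,
      lt_of_le_of_ne hle (e.1.injective.ne hhi.ne')⟩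
  · rintro ⟨e, he, hP, hV⟩ ⟨e', he', hP', hV'⟩ h
    have hmono : ∀ e : Equiv.Perm (Fin n), ltrMaxima e = P →
        StrictMono fun x : {x // x ∈ P} => e x := by
      rintro e rfl x y hxy
      have := y.2
      simp only [ltrMaxima, Finset.mem_filter, Finset.mem_univ, true_and] at this
      exact this x hxy
    have hrange : ∀ e : Equiv.Perm (Fin n), P.map e.toEmbedding = V →
        Set.range (fun x : {x // x ∈ P} => e x) = V := by
      rintro e rfl
      ext y
      simp only [Set.mem_range, Subtype.exists, exists_prop, Finset.mem_coe, Finset.mem_map,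
        Equiv.coe_toEmbedding]
    have hon := ((hmono e hP).range_inj (hmono e' hP')).1 ((hrange e hV).trans (hrange e' hV').symm)
    rw [Subtype.mk.injEq] at h ⊢
    ext1 x
    by_cases hx : x ∈ P
    · exact congrFun hon ⟨x, hx⟩
    · exact congrArg Subtype.val (Equiv.congr_fun h ⟨x, hx⟩)

theorem avoidCount_patt31245_le_sum (n : ℕ) : avoidCount patt31245 n ≤
    ∑ i ∈ Finset.range (n + 1), n.choose i * (n.choose i * (stackLevel (n - i)).length) := by
  classical
  rw [avoidCount_patt31245, Nat.card_eq_fintype_card, Fintype.card_subtype]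
  let φ : Equiv.Perm (Fin n) → Finset (Fin n) × Finset (Fin n) := fun e =>
    (ltrMaxima e, (ltrMaxima e).map e.toEmbedding)
  rw [Finset.card_eq_sum_card_fiberwise (f := φ)
    (t := Finset.univ.filter fun p => p.1.card = p.2.card) (by intro e _; simp [φ])]
  calc _ ≤ ∑ p : Finset (Fin n) × Finset (Fin n) with p.1.card = p.2.card,
        (stackLevel (n - p.1.card)).length := by
        refine Finset.sum_le_sum fun p hp => ?_
        refine le_trans (le_of_eq ?_) (card_fixed_ltrMaxima_le p.1 p.2 (Finset.mem_filter.1 hp).2)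
        rw [Nat.card_eq_fintype_card, Fintype.card_subtype, Finset.filter_filter]
        congr 1
        ext e
        simp only [φ, Finset.mem_filter, Finset.mem_univ, true_and, Prod.ext_iff]
        constructor
        · rintro ⟨h1, h2, h3⟩
          exact ⟨h1, h2, h2 ▸ h3⟩
        · rintro ⟨h1, h2, h3⟩
          exact ⟨h1, h2, h2.symm ▸ h3⟩
    _ = ∑ P : Finset (Fin n), n.choose P.card * (stackLevel (n - P.card)).length := by
        rw [Finset.sum_filter, Fintype.sum_prod_type]
        refine Finset.sum_congr rfl fun P _ => ?_
        rw [← Finset.sum_filter]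
        change ∑ V : Finset (Fin n) with P.card = V.card, (stackLevel (n - P.card)).length = _
        rw [Finset.sum_const, smul_eq_mul]
        congr 1
        rw [← Fintype.card_subtype]
        simp only [eq_comm (a := P.card)]
        rw [Fintype.card_finset_len, Fintype.card_fin]
    _ = _ := by
        rw [← Finset.powerset_univ, Finset.sum_powerset_apply_card
          (f := fun i => n.choose i * (stackLevel (n - i)).length)]
        simp

theorem one_add_sqrt_eight_sq : (1 + √8) ^ 2 = 9 + 4 * √2 := by
  have h8 : √8 = 2 * √2 := by
    rw [show (8 : ℝ) = 2 ^ 2 * 2 by norm_num, Real.sqrt_mul (by norm_num),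
      Real.sqrt_sq (by norm_num)]
  rw [h8]
  linear_combination 4 * Real.sq_sqrt (show (0 : ℝ) ≤ 2 by norm_num)

theorem eight_pow_eq_sqrt_pow_sq (k : ℕ) : (8 : ℝ) ^ k = (√8 ^ k) ^ 2 := by
  rw [← pow_mul, mul_comm, pow_mul, Real.sq_sqrt (by norm_num)]

theorem avoidCount_patt31245_le (n : ℕ) :
    (avoidCount patt31245 n : ℝ) ≤ 3 * (9 + 4 * √2) ^ n := by
  calc (avoidCount patt31245 n : ℝ)
      ≤ ∑ i ∈ Finset.range (n + 1),
          (n.choose i * (n.choose i * (stackLevel (n - i)).length) : ℝ) := by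
        exact_mod_cast avoidCount_patt31245_le_sum n
    _ ≤ ∑ i ∈ Finset.range (n + 1), 3 * (√8 ^ (n - i) * n.choose i) ^ 2 := by
        refine Finset.sum_le_sum fun i _ => ?_
        rw [mul_pow, ← eight_pow_eq_sqrt_pow_sq, sq (n.choose i : ℝ), ← mul_assoc, ← mul_assoc,
          mul_comm _ (_ * _ : ℝ)]
        gcongr
        exact length_stackLevel_le _
    _ ≤ 3 * (∑ i ∈ Finset.range (n + 1), √8 ^ (n - i) * n.choose i) ^ 2 := by
        rw [← Finset.mul_sum]
        gcongr
        exact Finset.sum_sq_le_sq_sum_of_nonneg fun i _ => by positivity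
    _ = _ := by
        rw [← one_add_sqrt_eight_sq, ← pow_mul, mul_comm 2 n, pow_mul, add_pow]
        simp

section Extension

open Sum.Lex

variable {α β : Type*} {K M : ℕ}

/-- The embedding of values which sends the `K` largest ones to the set `V` of new values. -/
def liftValue (V : Finset (Fin M)) (hV : V.card = K) (y : β ⊕ₗ Fin K) :
    (β ⊕ₗ Fin M) ⊕ₗ Fin K :=
  toLex (Sum.inl (toLex ((ofLex y).map id (V.orderEmbOfFin hV))))

/-- Extend `e` by `M` new positions and `M` new values: the new positions in `P` take the
`K` largest values in increasing order, and the other ones are filled by `σ`. -/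
def extendFun (e : α ≃ β ⊕ₗ Fin K) (P V : Finset (Fin M)) (hP : P.card = K) (hV : V.card = K)
    (σ : {x // x ∉ P} → {x // x ∉ V}) (x : α ⊕ₗ Fin M) : (β ⊕ₗ Fin M) ⊕ₗ Fin K :=
  Sum.elim (fun a => liftValue V hV (e a))
    (fun p => if h : p ∈ P then toLex (Sum.inr ((P.orderIsoOfFin hP).symm ⟨p, h⟩))
      else toLex (Sum.inl (toLex (Sum.inr (σ ⟨p, h⟩ : Fin M))))) (ofLex x)

variable (e : α ≃ β ⊕ₗ Fin K) {P V : Finset (Fin M)} (hP : P.card = K) (hV : V.card = K)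
  (σ : {x // x ∉ P} ≃ {x // x ∉ V})

theorem extendFun_inl (a : α) :
    extendFun e P V hP hV σ (toLex (Sum.inl a)) = liftValue V hV (e a) := rfl

theorem extendFun_inr_of_mem {p : Fin M} (h : p ∈ P) :
    extendFun e P V hP hV σ (toLex (Sum.inr p)) =
      toLex (Sum.inr ((P.orderIsoOfFin hP).symm ⟨p, h⟩)) := by
  simp [extendFun, h]

theorem extendFun_inr_of_notMem {p : Fin M} (h : p ∉ P) :
    extendFun e P V hP hV σ (toLex (Sum.inr p)) =
      toLex (Sum.inl (toLex (Sum.inr (σ ⟨p, h⟩ : Fin M)))) := by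
  simp [extendFun, h]

theorem liftValue_inr_ne (y : β ⊕ₗ Fin K) (z : {x // x ∉ V}) :
    liftValue V hV y ≠ toLex (Sum.inl (toLex (Sum.inr (z : Fin M)))) := by
  induction y using Lex.rec with | _ y
  rcases y with y | y
  · simp [liftValue]
  · intro h
    simp only [liftValue, ofLex_toLex, Sum.map_inr, EmbeddingLike.apply_eq_iff_eq,
      Sum.inl.injEq, Sum.inr.injEq] at h
    exact z.2 (h ▸ V.orderEmbOfFin_mem hV y)

theorem mem_iff_extendFun_inr {p : Fin M} :
    p ∈ P ↔ ∃ j, extendFun e P V hP hV σ (toLex (Sum.inr p)) = toLex (Sum.inr j) := by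
  by_cases h : p ∈ P
  · simp [extendFun_inr_of_mem _ _ _ _ h, h]
  · simp [extendFun_inr_of_notMem _ _ _ _ h, h]

theorem mem_iff_extendFun_inl {v : Fin M} :
    v ∈ V ↔ ∃ a, extendFun e P V hP hV σ (toLex (Sum.inl a)) =
      toLex (Sum.inl (toLex (Sum.inr v))) := by
  constructor
  · intro h
    rw [← Finset.mem_coe, ← V.range_orderEmbOfFin hV] at h
    obtain ⟨j, rfl⟩ := h
    exact ⟨e.symm (toLex (Sum.inr j)), by simp [extendFun_inl, liftValue]⟩
  · rintro ⟨a, h⟩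
    by_contra hv
    exact liftValue_inr_ne hV (e a) ⟨v, hv⟩ h

variable [LinearOrder β]

theorem strictMono_liftValue (V : Finset (Fin M)) (hV : V.card = K) :
    StrictMono (liftValue (β := β) V hV) := by
  intro x y h
  induction x using Lex.rec with | _ x
  induction y using Lex.rec with | _ y
  rcases x with x | x <;> rcases y with y | y
  · simpa [liftValue] using h
  · simp [liftValue]
  · exact absurd h not_inr_lt_inl
  · simpa [liftValue] using h

theorem extendFun_injective : Function.Injective (extendFun e P V hP hV σ) := by
  intro x y h
  induction x using Lex.rec with | _ x
  induction y using Lex.rec with | _ y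
  rcases x with x | x <;> rcases y with y | y
  · rw [extendFun_inl, extendFun_inl] at h
    rw [e.injective ((strictMono_liftValue V hV).injective h)]
  · rw [extendFun_inl] at h
    by_cases hy : y ∈ P
    · rw [extendFun_inr_of_mem _ _ _ _ hy] at h
      simp [liftValue] at h
    · rw [extendFun_inr_of_notMem _ _ _ _ hy] at h
      exact absurd h (liftValue_inr_ne hV _ _)
  · rw [extendFun_inl] at h
    by_cases hx : x ∈ P
    · rw [extendFun_inr_of_mem _ _ _ _ hx] at h
      simp [liftValue] at h
    · rw [extendFun_inr_of_notMem _ _ _ _ hx] at h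
      exact absurd h.symm (liftValue_inr_ne hV _ _)
  · by_cases hx : x ∈ P <;> by_cases hy : y ∈ P
    · rw [extendFun_inr_of_mem _ _ _ _ hx, extendFun_inr_of_mem _ _ _ _ hy] at h
      simpa using h
    · rw [extendFun_inr_of_mem _ _ _ _ hx, extendFun_inr_of_notMem _ _ _ _ hy] at h
      simp at h
    · rw [extendFun_inr_of_notMem _ _ _ _ hx, extendFun_inr_of_mem _ _ _ _ hy] at h
      simp at h
    · rw [extendFun_inr_of_notMem _ _ _ _ hx, extendFun_inr_of_notMem _ _ _ _ hy] at h
      simpa [Subtype.val_inj] using h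

variable [LinearOrder α]

/-- The bijection `e` avoids `54213` and takes its `K` largest values in increasing order. -/
def IsExtendable (e : α ≃ β ⊕ₗ Fin K) : Prop :=
  ¬ Has54213 e ∧ StrictMono fun j : Fin K => e.symm (toLex (Sum.inr j))

/-- A position of an extension whose value is exceeded earlier is either an old position with
a value below the `K` largest, or a new position outside `P`. -/
theorem extendFun_exceeded_cases (he : IsExtendable e) {x y : α ⊕ₗ Fin M} (hyx : y < x)
    (hlt : extendFun e P V hP hV σ x < extendFun e P V hP hV σ y) :
    (∃ a b, x = toLex (Sum.inl a) ∧ e a = toLex (Sum.inl b)) ∨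
      ∃ p, p ∉ P ∧ x = toLex (Sum.inr p) := by
  induction x using Lex.rec with | _ x
  induction y using Lex.rec with | _ y
  rcases x with x | x
  · left
    rcases y with y | y
    swap
    · exact absurd hyx not_inr_lt_inl
    rw [extendFun_inl, extendFun_inl, (strictMono_liftValue V hV).lt_iff_lt] at hlt
    rw [inl_lt_inl_iff] at hyx
    obtain ⟨b | j, hb⟩ : ∃ z, e x = toLex z := ⟨ofLex (e x), rfl⟩
    · exact ⟨x, b, rfl, hb⟩
    · obtain ⟨b | j', hb'⟩ : ∃ z, e y = toLex z := ⟨ofLex (e y), rfl⟩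
      · rw [hb, hb'] at hlt
        exact absurd hlt not_inr_lt_inl
      · rw [hb, hb', inr_lt_inr_iff] at hlt
        rw [← Equiv.eq_symm_apply] at hb hb'
        have := he.2 hlt
        simp only [← hb, ← hb'] at this
        exact absurd this hyx.asymm
  · right
    refine ⟨x, fun hx => ?_, rfl⟩
    rw [extendFun_inr_of_mem _ _ _ _ hx] at hlt
    rcases y with y | y
    · exact absurd hlt not_inr_lt_inl
    · by_cases hy : y ∈ P
      · rw [extendFun_inr_of_mem _ _ _ _ hy, inr_lt_inr_iff, OrderIso.lt_iff_lt] at hlt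
        exact absurd (inr_lt_inr_iff.1 hyx) (not_lt_of_gt hlt)
      · rw [extendFun_inr_of_notMem _ _ _ _ hy] at hlt
        exact absurd hlt not_inr_lt_inl

theorem not_has54213_extendFun (he : IsExtendable e) (hσ : ¬ Has4213 σ) :
    ¬ Has54213 (extendFun e P V hP hV σ) := by
  rintro ⟨h, i, j, k, l, hi, ij, jk, kl, h1, h2, h3, h4⟩
  have ci := extendFun_exceeded_cases e hP hV σ he hi h4
  have cj := extendFun_exceeded_cases e hP hV σ he (hi.trans ij) (h2.trans (h3.trans h4))
  have ck := extendFun_exceeded_cases e hP hV σ he (hi.trans (ij.trans jk))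
    (h1.trans (h2.trans (h3.trans h4)))
  have cl := extendFun_exceeded_cases e hP hV σ he (hi.trans (ij.trans (jk.trans kl)))
    (h3.trans h4)
  have below : ∀ x y : α ⊕ₗ Fin M, ∀ a b, x = toLex (Sum.inl a) → e a = toLex (Sum.inl b) →
      (∃ p, p ∉ P ∧ y = toLex (Sum.inr p)) →
      ¬ extendFun e P V hP hV σ y < extendFun e P V hP hV σ x := by
    rintro _ _ a b rfl hab ⟨p, hp, rfl⟩ hlt
    rw [extendFun_inl, extendFun_inr_of_notMem _ _ _ _ hp, hab] at hlt
    simp [liftValue] at hlt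
  rcases ci with ⟨i, bi, rfl, ei⟩ | ⟨i, hiP, rfl⟩
  · obtain ⟨l, bl, rfl, el⟩ := cl.resolve_right fun c => below _ _ i bi rfl ei c h3
    obtain ⟨j, bj, rfl, ej⟩ := cj.resolve_right fun c => below _ _ i bi rfl ei c (h2.trans h3)
    obtain ⟨k, bk, rfl, ek⟩ := ck.resolve_right fun c =>
      below _ _ i bi rfl ei c (h1.trans (h2.trans h3))
    induction h using Lex.rec with | _ h
    rcases h with h | h
    · have hlift := fun x y => (strictMono_liftValue (β := β) V hV).lt_iff_lt (a := x) (b := y)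
      simp only [extendFun_inl, hlift] at h1 h2 h3 h4
      rw [inl_lt_inl_iff] at hi ij jk kl
      exact he.1 ⟨h, i, j, k, l, hi, ij, jk, kl, h1, h2, h3, h4⟩
    · exact not_inr_lt_inl hi
  · have right : ∀ x y : α ⊕ₗ Fin M, ((∃ a b, x = toLex (Sum.inl a) ∧ e a = toLex (Sum.inl b)) ∨
        ∃ p, p ∉ P ∧ x = toLex (Sum.inr p)) → y < x → (∃ p, y = toLex (Sum.inr p)) →
        ∃ p, p ∉ P ∧ x = toLex (Sum.inr p) := by
      rintro x y (⟨a, b, rfl, -⟩ | hx) hyx ⟨p, rfl⟩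
      · exact absurd hyx not_inr_lt_inl
      · exact hx
    obtain ⟨j, hjP, rfl⟩ := right _ _ cj ij ⟨i, rfl⟩
    obtain ⟨k, hkP, rfl⟩ := right _ _ ck jk ⟨j, rfl⟩
    obtain ⟨l, hlP, rfl⟩ := right _ _ cl kl ⟨k, rfl⟩
    rw [inr_lt_inr_iff] at ij jk kl
    simp only [extendFun_inr_of_notMem, hiP, hjP, hkP, hlP, not_false_eq_true, inl_lt_inl_iff,
      inr_lt_inr_iff] at h1 h2 h3
    exact hσ ⟨⟨i, hiP⟩, ⟨j, hjP⟩, ⟨k, hkP⟩, ⟨l, hlP⟩, ij, jk, kl, h1, h2, h3⟩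

variable [Fintype α] [Fintype β]

/-- The function `extendFun` as a bijection. -/
noncomputable def extendEquiv (hcard : Fintype.card α = Fintype.card β + K) :
    α ⊕ₗ Fin M ≃ (β ⊕ₗ Fin M) ⊕ₗ Fin K :=
  Equiv.ofBijective (extendFun e P V hP hV σ)
    ((Fintype.bijective_iff_injective_and_card _).2 ⟨extendFun_injective e hP hV σ, by
      simp [hcard]; omega⟩)

theorem isExtendable_extendEquiv (hcard : Fintype.card α = Fintype.card β + K)
    (he : IsExtendable e) (hσ : ¬ Has4213 σ) :
    IsExtendable (extendEquiv e hP hV σ hcard) := by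
  refine ⟨not_has54213_extendFun e hP hV σ he hσ, ?_⟩
  have h : ∀ j, (extendEquiv e hP hV σ hcard).symm (toLex (Sum.inr j)) =
      toLex (Sum.inr (P.orderEmbOfFin hP j)) := by
    intro j
    rw [Equiv.symm_apply_eq]
    refine ((extendFun_inr_of_mem e hP hV σ (P.orderEmbOfFin_mem hP j)).trans ?_).symm
    exact congrArg (toLex ∘ Sum.inr) ((P.orderIsoOfFin hP).symm_apply_apply j)
  intro j j' hj
  simp only [h]
  simpa using hj

/-- The extendable bijections between two given ordered sets. -/
abbrev Extendable (α β : Type*) [LinearOrder α] [LinearOrder β] (K : ℕ) :=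
  {e : α ≃ β ⊕ₗ Fin K // IsExtendable e}

/-- The data from which an extendable bijection is enlarged by `M` positions and values. -/
abbrev ExtensionData (K M : ℕ) :=
  (S : {P : Finset (Fin M) // P.card = K} × {V : Finset (Fin M) // V.card = K}) ×
    {σ : {x // x ∉ S.1.1} ≃ {x // x ∉ S.2.1} // ¬ Has4213 σ}

theorem card_extensionData (K M : ℕ) : Nat.card (ExtensionData K M) =
    M.choose K ^ 2 * (stackLevel (M - K)).length := by
  rw [Nat.card_sigma]
  have h : ∀ S : {P : Finset (Fin M) // P.card = K} × {V : Finset (Fin M) // V.card = K},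
      Nat.card {σ : {x // x ∉ S.1.1} ≃ {x // x ∉ S.2.1} // ¬ Has4213 σ} =
        (stackLevel (M - K)).length := fun S =>
    card_equiv_avoiding_4213 (by simp [Fintype.card_subtype_compl, S.1.2])
      (by simp [Fintype.card_subtype_compl, S.2.2])
  simp only [h, Finset.sum_const, Finset.card_univ, Fintype.card_prod, smul_eq_mul,
    Fintype.card_finset_len, Fintype.card_fin, sq]

theorem card_extendable_mul_le (M : ℕ) (hcard : Fintype.card α = Fintype.card β + K) :
    Nat.card (Extendable α β K) * (M.choose K ^ 2 * (stackLevel (M - K)).length) ≤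
      Nat.card (Extendable (α ⊕ₗ Fin M) (β ⊕ₗ Fin M) K) := by
  rw [← card_extensionData, ← Nat.card_prod]
  refine Nat.card_le_card_of_injective (fun x : Extendable α β K × ExtensionData K M =>
    ⟨extendEquiv x.1.1 x.2.1.1.2 x.2.1.2.2 x.2.2.1 hcard,
      isExtendable_extendEquiv _ _ _ _ hcard x.1.2 x.2.2.2⟩) ?_
  rintro ⟨⟨e, he⟩, ⟨⟨⟨P, hP⟩, ⟨V, hV⟩⟩, ⟨σ, hσ⟩⟩⟩ ⟨⟨e', he'⟩, ⟨⟨⟨P', hP'⟩, ⟨V', hV'⟩⟩, ⟨σ', hσ'⟩⟩⟩ h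
  have hF : extendFun e P V hP hV σ = extendFun e' P' V' hP' hV' σ' :=
    congrArg DFunLike.coe (Subtype.mk.inj h)
  have hPP : P = P' := by
    ext p
    rw [mem_iff_extendFun_inr e hP hV σ, hF, ← mem_iff_extendFun_inr]
  have hVV : V = V' := by
    ext v
    rw [mem_iff_extendFun_inl e hP hV σ, hF, ← mem_iff_extendFun_inl]
  subst hPP hVV
  have hee : e = e' := by
    ext1 a
    exact (strictMono_liftValue V hV).injective (congrFun hF (toLex (Sum.inl a)))
  have hσσ : σ = σ' := by
    ext1 x
    have := congrFun hF (toLex (Sum.inr x.1))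
    rw [extendFun_inr_of_notMem _ _ _ _ x.2, extendFun_inr_of_notMem _ _ _ _ x.2] at this
    simpa [Subtype.val_inj] using this
  subst hee hσσ
  rfl

end Extension

theorem card_extendable_congr {α β α' β' : Type*} [LinearOrder α] [LinearOrder β]
    [LinearOrder α'] [LinearOrder β'] {K : ℕ} (a : α ≃o α') (b : β ≃o β') :
    Nat.card (Extendable α β K) = Nat.card (Extendable α' β' K) := by
  let c : β ⊕ₗ Fin K ≃o β' ⊕ₗ Fin K := OrderIso.sumLexCongr b (OrderIso.refl _)
  refine Nat.card_congr (Equiv.subtypeEquiv (Equiv.equivCongr a.toEquiv c.toEquiv) fun e => ?_)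
  refine and_congr (not_congr ⟨?_, ?_⟩) ?_
  · rintro ⟨h, i, j, k, l, hs⟩
    refine ⟨a h, a i, a j, a k, a l, ?_⟩
    simpa [Equiv.equivCongr] using hs
  · rintro ⟨h, i, j, k, l, hs⟩
    refine ⟨a.symm h, a.symm i, a.symm j, a.symm k, a.symm l, ?_⟩
    simpa [Equiv.equivCongr] using hs
  · have h : ∀ j : Fin K, c.symm (toLex (Sum.inr j)) = toLex (Sum.inr j) := fun j => rfl
    simp [StrictMono, Equiv.equivCongr, h]

/-- The number of extendable bijections of size `n + K`. -/
noncomputable def extendableCount (n K : ℕ) : ℕ := Nat.card (Extendable (Fin (n + K)) (Fin n) K)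

theorem extendableCount_mul_le (n K M : ℕ) :
    extendableCount n K * (M.choose K ^ 2 * (stackLevel (M - K)).length) ≤
      extendableCount (n + M) K := by
  refine (card_extendable_mul_le M (by simp)).trans (le_of_eq (card_extendable_congr ?_ ?_))
  · exact (Fintype.orderIsoFinOfCardEq _ (by simp; omega)).symm
  · exact (Fintype.orderIsoFinOfCardEq _ (by simp)).symm

theorem one_le_extendableCount (n K : ℕ) : 1 ≤ extendableCount n K := by
  let c : Fin (n + K) ≃o Fin n ⊕ₗ Fin K := Fintype.orderIsoFinOfCardEq _ (by simp)
  have hc : IsExtendable c.toEquiv := by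
    constructor
    · rintro ⟨h, i, j, k, l, -, -, hjk, -, hs, -⟩
      exact hs.not_gt (c.strictMono hjk)
    · intro j j' h
      exact c.symm.strictMono (Sum.Lex.inr_lt_inr_iff.2 h)
  have : Nonempty (Extendable (Fin (n + K)) (Fin n) K) := ⟨⟨_, hc⟩⟩
  exact Nat.card_pos

theorem pow_le_extendableCount (r K M m : ℕ) :
    (M.choose K ^ 2 * (stackLevel (M - K)).length) ^ m ≤ extendableCount (r + m * M) K := by
  induction m with
  | zero => simpa using one_le_extendableCount r K
  | succ m ih =>
    rw [pow_succ, add_one_mul, ← add_assoc]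
    exact (Nat.mul_le_mul_right _ ih).trans (extendableCount_mul_le _ _ _)

theorem extendableCount_le (n K : ℕ) :
    extendableCount n K ≤ Nat.card {e : Equiv.Perm (Fin (n + K)) // ¬ Has54213 e} := by
  let c : Fin n ⊕ₗ Fin K ≃o Fin (n + K) := (Fintype.orderIsoFinOfCardEq _ (by simp)).symm
  refine Nat.card_le_card_of_injective (fun e => ⟨e.1.trans c.toEquiv, ?_⟩) ?_
  · rintro ⟨h, i, j, k, l, hs⟩
    exact e.2.1 ⟨h, i, j, k, l, by simpa using hs⟩
  · intro e e' h
    rw [Subtype.mk.injEq] at h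
    refine Subtype.ext (Equiv.ext fun x => c.injective ?_)
    exact Equiv.congr_fun h x

theorem exists_growth_pow_le (M : ℕ) : ∃ K ≤ M, (9 + 4 * √2) ^ M ≤
    16 * (M + 1 : ℝ) ^ 5 * (M.choose K ^ 2 * (stackLevel (M - K)).length : ℕ) := by
  obtain ⟨K, hK, hmax⟩ := (Finset.range (M + 1)).exists_max_image
    (fun i => √8 ^ (M - i) * (M.choose i : ℝ)) ⟨0, by simp⟩
  have hKM : K ≤ M := by simpa [Nat.lt_succ_iff] using hK
  refine ⟨K, hKM, ?_⟩
  have hsum : (1 + √8) ^ M ≤ (M + 1) * (√8 ^ (M - K) * M.choose K) := by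
    rw [add_pow]
    refine (Finset.sum_le_card_nsmul _ _ _ fun i hi => ?_).trans_eq (by
      rw [Finset.card_range, nsmul_eq_mul, Nat.cast_add_one])
    simpa using hmax i hi
  have hMK : ((M - K : ℕ) : ℝ) ≤ M := by exact_mod_cast Nat.sub_le M K
  calc (9 + 4 * √2) ^ M = ((1 + √8) ^ M) ^ 2 := by
        rw [← one_add_sqrt_eight_sq, ← pow_mul, ← pow_mul, mul_comm]
    _ ≤ ((M + 1) * (√8 ^ (M - K) * M.choose K)) ^ 2 := by gcongr
    _ = (M + 1) ^ 2 * M.choose K ^ 2 * 8 ^ (M - K) := by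
        rw [eight_pow_eq_sqrt_pow_sq]
        ring
    _ ≤ (M + 1) ^ 2 * M.choose K ^ 2 *
        (16 * ((M - K : ℕ) + 1) ^ 3 * (stackLevel (M - K)).length) := by
        gcongr
        exact pow_le_length_stackLevel _
    _ ≤ (M + 1) ^ 2 * M.choose K ^ 2 * (16 * (M + 1) ^ 3 * (stackLevel (M - K)).length) := by
        gcongr
    _ = _ := by
        push_cast
        ring

theorem pow_le_avoidCount {n K M : ℕ} (hn : K ≤ n) :
    (M.choose K ^ 2 * (stackLevel (M - K)).length) ^ ((n - K) / M) ≤ avoidCount patt31245 n := by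
  have h := (pow_le_extendableCount ((n - K) % M) K M ((n - K) / M)).trans (extendableCount_le _ K)
  have e : (n - K) % M + (n - K) / M * M + K = n := by
    rw [mul_comm, Nat.mod_add_div, Nat.sub_add_cancel hn]
  rw [avoidCount_patt31245]
  rwa [e] at h

theorem tendsto_log_poly_div :
    Tendsto (fun M : ℕ => Real.log (16 * (M + 1 : ℝ) ^ 5) / M) atTop (nhds 0) := by
  have h1 : Tendsto (fun M : ℕ => Real.log 16 / M) atTop (nhds 0) :=
    tendsto_const_div_atTop_nhds_zero_nat _
  have h2 := (Real.tendsto_pow_log_div_mul_add_atTop 1 (-1) 1 one_ne_zero).comp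
    (tendsto_atTop_add_const_right atTop (1 : ℝ) tendsto_natCast_atTop_atTop)
  have h3 := h1.add (h2.const_mul 5)
  simp only [mul_zero, add_zero] at h3
  refine h3.congr fun M => ?_
  rw [Real.log_mul (by norm_num) (by positivity), Real.log_pow]
  simp only [Function.comp, pow_one, one_mul, add_neg_cancel_right]
  push_cast
  ring

theorem exists_log_growth_le {M : ℕ} (hM : 1 ≤ M) : ∃ a : ℝ,
    Real.log (9 + 4 * √2) - Real.log (16 * (M + 1 : ℝ) ^ 5) / M ≤ a / M ∧
      ∀ᶠ n : ℕ in atTop, (a / M - 2 * a / n ≤ Real.log (avoidCount patt31245 n) / n) ∧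
        1 ≤ avoidCount patt31245 n := by
  obtain ⟨K, hKM, hK⟩ := exists_growth_pow_le M
  set A := M.choose K ^ 2 * (stackLevel (M - K)).length with hA
  have hM0 : (0 : ℝ) < M := by exact_mod_cast hM
  have hlam : (0 : ℝ) < 9 + 4 * √2 := by positivity
  have hA1 : 1 ≤ A := by
    rcases Nat.eq_zero_or_pos A with h | h
    · rw [h] at hK
      have := pow_pos hlam M
      simp at hK
      linarith
    · exact h
  have hA1' : (1 : ℝ) ≤ A := by exact_mod_cast hA1
  have hlogA : 0 ≤ Real.log A := Real.log_nonneg hA1'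
  refine ⟨Real.log A, ?_, ?_⟩
  · have h := Real.log_le_log (pow_pos hlam M) hK
    rw [Real.log_pow, Real.log_mul (by positivity) (by positivity)] at h
    rw [sub_le_iff_le_add, ← add_div, le_div_iff₀ hM0]
    linarith
  · filter_upwards [eventually_ge_atTop (K + 1)] with n hn
    have hpow := pow_le_avoidCount (n := n) (K := K) (M := M) (by omega)
    rw [← hA] at hpow
    refine ⟨?_, (Nat.one_le_pow _ _ hA1).trans hpow⟩
    have hn0 : (0 : ℝ) < n := by exact_mod_cast (by omega : 0 < n)
    have hm : (n : ℝ) / M - 2 ≤ ((n - K) / M : ℕ) := by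
      rw [sub_le_iff_le_add, div_le_iff₀ hM0]
      have h1 := Nat.lt_div_mul_add hM (a := n - K)
      have h2 : n ≤ ((n - K) / M + 2) * M := by
        rw [add_mul]
        omega
      exact_mod_cast h2
    have hlog : ((n - K) / M : ℕ) * Real.log A ≤ Real.log (avoidCount patt31245 n) := by
      rw [← Real.log_pow]
      exact Real.log_le_log (by positivity) (by exact_mod_cast hpow)
    rw [le_div_iff₀ hn0]
    calc (Real.log A / M - 2 * Real.log A / n) * n = (n / M - 2) * Real.log A := by
          field_simp
      _ ≤ _ := (mul_le_mul_of_nonneg_right hm hlogA).trans hlog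

theorem tendsto_log_avoidCount :
    Tendsto (fun n : ℕ => Real.log (avoidCount patt31245 n) / n) atTop
      (nhds (Real.log (9 + 4 * √2))) := by
  have hlam : (0 : ℝ) < 9 + 4 * √2 := by positivity
  refine tendsto_order.2 ⟨fun c hc => ?_, fun c hc => ?_⟩
  · have h := (tendsto_const_nhds (x := Real.log (9 + 4 * √2))).sub tendsto_log_poly_div
    rw [sub_zero] at h
    obtain ⟨M, hcM, hM⟩ := ((h.eventually (lt_mem_nhds hc)).and (eventually_ge_atTop 1)).exists
    obtain ⟨a, ha, hev⟩ := exists_log_growth_le hM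
    have hlim := (tendsto_const_nhds (x := a / M)).sub
      (tendsto_const_div_atTop_nhds_zero_nat (2 * a))
    rw [sub_zero] at hlim
    filter_upwards [hev, hlim.eventually (lt_mem_nhds (hcM.trans_le ha))] with n h1 h2
    exact h2.trans_le h1.1
  · have hlim := (tendsto_const_div_atTop_nhds_zero_nat (Real.log 3)).add
      (tendsto_const_nhds (x := Real.log (9 + 4 * √2)))
    rw [zero_add] at hlim
    obtain ⟨a, -, hev⟩ := exists_log_growth_le le_rfl
    filter_upwards [hlim.eventually (gt_mem_nhds hc), hev, eventually_ge_atTop 1] with n h1 h2 h3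
    refine lt_of_le_of_lt ?_ h1
    have hn0 : (0 : ℝ) < n := by exact_mod_cast h3
    have h := Real.log_le_log (by exact_mod_cast h2.2) (avoidCount_patt31245_le n)
    rw [Real.log_mul (by norm_num) (by positivity), Real.log_pow] at h
    rw [div_le_iff₀ hn0, add_mul, div_mul_cancel₀ _ hn0.ne']
    linarith

/-- Bóna: the Stanley–Wilf growth constant of the pattern `31245` is `9 + 4√2`. -/
theorem stmt_12 :
    Tendsto (fun n : ℕ => (avoidCount patt31245 n : ℝ) ^ (1 / (n : ℝ)))
      atTop (nhds (9 + 4 * Real.sqrt 2)) := by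
  have h := (Real.continuous_exp.tendsto _).comp tendsto_log_avoidCount
  rw [Real.exp_log (by positivity)] at h
  obtain ⟨a, -, hev⟩ := exists_log_growth_le le_rfl
  refine h.congr' ?_
  filter_upwards [hev] with n hn
  rw [Real.rpow_def_of_pos (by exact_mod_cast hn.2), Function.comp, mul_one_div]
end

section
/- (Backelin–West–Xin) Let 1 ≤ k ≤ l and let σ and σ' be permutations of {1,…,l} that agree on positions k+1,…,l and take values in {k+1,…,l} there, while on the first k positions σ takes the values 1,2,…,k in increasing order (σ(i) = i for i ≤ k viewed as the pattern 12⋯k followed by τ) and σ' takes the values k,k−1,…,1 in decreasing order (σ'(i) = k+1−i for i ≤ k). Then for every n ≥ 0, s_n(σ) = s_n(σ'): the patterns 12⋯kτ and k(k−1)⋯1τ are Wilf-equivalent. -/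
namespace BackelinWestXin

/-- `mu` is obtained from `la` by adding one cell in row `r`. -/
def AddRow (r : ℕ) (la mu : YoungDiagram) : Prop :=
  ∀ s, mu.rowLen s = la.rowLen s + if s = r then 1 else 0

/-- `mu` is obtained from `la` by adding at most one cell. -/
def AddLeOne (la mu : YoungDiagram) : Prop :=
  la = mu ∨ ∃ r, AddRow r la mu

theorem ext_rowLen {la mu : YoungDiagram} (h : ∀ s, la.rowLen s = mu.rowLen s) : la = mu := by
  ext ⟨i, j⟩
  rw [YoungDiagram.mem_cells, YoungDiagram.mem_cells, YoungDiagram.mem_iff_lt_rowLen,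
    YoungDiagram.mem_iff_lt_rowLen, h]

theorem exists_of_rowLen (f : ℕ → ℕ) (hf : Antitone f) (N : ℕ) (hN : ∀ r, N ≤ r → f r = 0) :
    ∃ la : YoungDiagram, ∀ s, la.rowLen s = f s := by
  have hlow : IsLowerSet (((Finset.range N ×ˢ Finset.range (f 0)).filter
      fun c => c.2 < f c.1 : Finset (ℕ × ℕ)) : Set (ℕ × ℕ)) := by
    rintro ⟨a, b⟩ ⟨c, d⟩ hcd hab
    obtain ⟨hca : c ≤ a, hdb : d ≤ b⟩ := hcd
    have h1 := hf hca
    simp only [Finset.coe_filter, Finset.mem_product, Finset.mem_range, Set.mem_ofPred_eq] at hab ⊢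
    omega
  refine ⟨⟨_, hlow⟩, fun s => eq_of_forall_lt_iff fun c => ?_⟩
  rw [← YoungDiagram.mem_iff_lt_rowLen, YoungDiagram.mem_mk, Finset.mem_filter,
    Finset.mem_product, Finset.mem_range, Finset.mem_range]
  refine ⟨fun h => h.2, fun h => ⟨⟨Nat.lt_of_not_le fun h' => ?_, ?_⟩, h⟩⟩
  · simp [hN s h'] at h
  · exact h.trans_le (hf (Nat.zero_le s))

theorem rowLen_eq_zero_of_le (la : YoungDiagram) {r : ℕ} (h : la.colLen 0 ≤ r) :
    la.rowLen r = 0 := by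
  by_contra h0
  have := (YoungDiagram.mem_iff_lt_rowLen (μ := la)).2 (Nat.pos_of_ne_zero h0)
  rw [YoungDiagram.mem_iff_lt_colLen] at this
  omega

theorem exists_of_rowLen_le (f : ℕ → ℕ) (hf : ∀ r, f (r + 1) ≤ f r) (la : YoungDiagram) (t : ℕ)
    (hla : ∀ r, t < r → f r ≤ la.rowLen r) : ∃ mu : YoungDiagram, ∀ s, mu.rowLen s = f s := by
  refine exists_of_rowLen f (antitone_nat_of_succ_le hf) (la.colLen 0 + t + 1) fun r hr => ?_
  have := hla r (by omega)
  rw [rowLen_eq_zero_of_le la (by omega)] at this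
  omega

namespace AddRow

variable {r s : ℕ} {a b c : YoungDiagram}

theorem ne (h : AddRow r a b) : a ≠ b := by
  rintro rfl
  simpa using h r

theorem right_unique (h : AddRow r a b) (h' : AddRow r a c) : b = c :=
  ext_rowLen fun t => by rw [h t, h' t]

theorem left_unique (h : AddRow r a c) (h' : AddRow r b c) : a = b :=
  ext_rowLen fun t => by have := h t; have := h' t; omega

theorem index_unique (h : AddRow r a b) (h' : AddRow s a b) : r = s := by
  by_contra hne
  have h1 := h r
  have h2 := h' r
  simp [hne] at h1 h2
  omega

theorem exists_add_zero (a : YoungDiagram) : ∃ b, AddRow 0 a b := by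
  refine exists_of_rowLen_le (fun t => a.rowLen t + if t = 0 then 1 else 0) ?_ a 0 ?_
  · intro t
    grind [a.rowLen_anti t (t + 1) (by omega)]
  · grind

theorem exists_add_succ (h : AddRow r a b) : ∃ c, AddRow (r + 1) b c := by
  refine exists_of_rowLen_le (fun t => b.rowLen t + if t = r + 1 then 1 else 0) ?_ b (r + 1) ?_
  · intro t
    grind [a.rowLen_anti t (t + 1) (by omega), b.rowLen_anti t (t + 1) (by omega), h t, h (t + 1)]
  · grind

theorem exists_sub_pred (h : AddRow (r + 1) b c) : ∃ a, AddRow r a b := by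
  have hr : 0 < b.rowLen r := by
    grind [c.rowLen_anti r (r + 1) (by omega), h r, h (r + 1)]
  have : ∃ a : YoungDiagram, ∀ t, a.rowLen t = b.rowLen t - if t = r then 1 else 0 := by
    refine exists_of_rowLen_le _ ?_ b 0 ?_
    · intro t
      grind [c.rowLen_anti t (t + 1) (by omega), b.rowLen_anti t (t + 1) (by omega),
        h t, h (t + 1)]
    · grind
  obtain ⟨a, ha⟩ := this
  exact ⟨a, fun t => by grind [ha t]⟩

theorem exists_join (hne : r ≠ s) (h : AddRow r a b) (h' : AddRow s a c) :
    ∃ d, AddRow s b d ∧ AddRow r c d := by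
  have : ∃ d : YoungDiagram, ∀ t, d.rowLen t = b.rowLen t + if t = s then 1 else 0 := by
    refine exists_of_rowLen_le _ ?_ b s ?_
    · intro t
      grind [b.rowLen_anti t (t + 1) (by omega), c.rowLen_anti t (t + 1) (by omega),
        h t, h (t + 1), h' t, h' (t + 1)]
    · grind
  obtain ⟨d, hd⟩ := this
  exact ⟨d, hd, fun t => by grind [hd t, h t, h' t]⟩

theorem exists_meet (hne : r ≠ s) (h : AddRow s b a) (h' : AddRow r c a) :
    ∃ d, AddRow r d b ∧ AddRow s d c := by
  have : ∃ d : YoungDiagram, ∀ t, d.rowLen t = b.rowLen t - if t = r then 1 else 0 := by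
    refine exists_of_rowLen_le _ ?_ b 0 ?_
    · intro t
      grind [b.rowLen_anti t (t + 1) (by omega), c.rowLen_anti t (t + 1) (by omega),
        h t, h (t + 1), h' t, h' (t + 1)]
    · grind
  obtain ⟨d, hd⟩ := this
  exact ⟨d, fun t => by grind [hd t, h t, h' t], fun t => by grind [hd t, h t, h' t]⟩

theorem transpose (h : AddRow r a b) : AddRow (a.rowLen r) a.transpose b.transpose := by
  have hmem : ∀ i j, i < b.colLen j ↔ i < a.colLen j ∨ (i = r ∧ j = a.rowLen r) := by
    intro i j
    rw [← YoungDiagram.mem_iff_lt_colLen, ← YoungDiagram.mem_iff_lt_colLen,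
      YoungDiagram.mem_iff_lt_rowLen, YoungDiagram.mem_iff_lt_rowLen, h i]
    split_ifs with hi
    · subst hi; omega
    · omega
  intro j
  rw [YoungDiagram.rowLen_transpose, YoungDiagram.rowLen_transpose]
  have h1 := hmem (a.colLen j) j
  have h2 := hmem (b.colLen j) j
  have h3 := hmem r j
  have h4 := hmem (r - 1) j
  have h5 := hmem (a.colLen j + 1) j
  have h6 : ¬ r < a.colLen (a.rowLen r) := by
    rw [← YoungDiagram.mem_iff_lt_colLen, YoungDiagram.mem_iff_lt_rowLen]
    omega
  split_ifs with hj
  · subst hj; omega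
  · omega

end AddRow

theorem AddLeOne.transpose {a b : YoungDiagram} (h : AddLeOne a b) :
    AddLeOne a.transpose b.transpose := by
  rcases h with rfl | ⟨r, h⟩
  · exact Or.inl rfl
  · exact Or.inr ⟨_, h.transpose⟩

theorem AddLeOne.rowLen_le {a b : YoungDiagram} (h : AddLeOne a b) (s : ℕ) :
    a.rowLen s ≤ b.rowLen s := by
  rcases h with rfl | ⟨r, h⟩
  · exact le_rfl
  · rw [h s]; omega

theorem AddLeOne.eq_bot {a : YoungDiagram} (h : AddLeOne a ⊥) : a = ⊥ := by
  refine ext_rowLen fun s => Nat.le_antisymm (h.rowLen_le s) ?_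
  refine Nat.le_of_not_lt fun h' => ?_
  rw [← YoungDiagram.mem_iff_lt_rowLen] at h'
  exact YoungDiagram.notMem_bot _ h'

/-- Fomin's local rule for a cell of a growth diagram with south-west corner `a`, south-east
corner `b`, north-west corner `c` and north-east corner `d`; `m` says that the cell is marked. -/
def LocalRule (a b c d : YoungDiagram) (m : Prop) : Prop :=
  (¬ m ∧ a = b ∧ c = d ∧ AddLeOne a c) ∨
  (¬ m ∧ a = c ∧ b = d ∧ AddLeOne a b) ∨
  (m ∧ a = b ∧ a = c ∧ AddRow 0 b d) ∨
  (¬ m ∧ b = c ∧ ∃ r, AddRow r a b ∧ AddRow (r + 1) b d) ∨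
  (¬ m ∧ ∃ r s, r ≠ s ∧ AddRow r a b ∧ AddRow s a c ∧ AddRow s b d ∧ AddRow r c d)

namespace LocalRule

variable {a a' b c d d' : YoungDiagram} {m m' : Prop}

theorem exists_forward (hb : AddLeOne a b) (hc : AddLeOne a c) (hm : m → a = b ∧ a = c) :
    ∃ d, LocalRule a b c d m := by
  by_cases h : m
  · obtain ⟨d, hd⟩ := AddRow.exists_add_zero b
    exact ⟨d, Or.inr (Or.inr (Or.inl ⟨h, (hm h).1, (hm h).2, hd⟩))⟩
  rcases hb with rfl | ⟨r, hr⟩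
  · exact ⟨c, Or.inl ⟨h, rfl, rfl, hc⟩⟩
  rcases hc with rfl | ⟨s, hs⟩
  · exact ⟨b, Or.inr (Or.inl ⟨h, rfl, rfl, Or.inr ⟨r, hr⟩⟩)⟩
  by_cases hrs : r = s
  · subst hrs
    obtain ⟨d, hd⟩ := hr.exists_add_succ
    exact ⟨d, Or.inr (Or.inr (Or.inr (Or.inl ⟨h, hr.right_unique hs, r, hr, hd⟩)))⟩
  · obtain ⟨d, h1, h2⟩ := AddRow.exists_join hrs hr hs
    exact ⟨d, Or.inr (Or.inr (Or.inr (Or.inr ⟨h, r, s, hrs, hr, hs, h1, h2⟩)))⟩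

theorem exists_backward (hb : AddLeOne b d) (hc : AddLeOne c d) :
    ∃ a m, LocalRule a b c d m := by
  rcases hb with rfl | ⟨s, hs⟩
  · exact ⟨c, False, Or.inr (Or.inl ⟨id, rfl, rfl, hc⟩)⟩
  rcases hc with rfl | ⟨r, hr⟩
  · exact ⟨b, False, Or.inl ⟨id, rfl, rfl, Or.inr ⟨s, hs⟩⟩⟩
  by_cases hrs : r = s
  · subst hrs
    obtain rfl := hs.left_unique hr
    rcases r with _ | r
    · exact ⟨b, True, Or.inr (Or.inr (Or.inl ⟨trivial, rfl, rfl, hr⟩))⟩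
    · obtain ⟨a, ha⟩ := hr.exists_sub_pred
      exact ⟨a, False, Or.inr (Or.inr (Or.inr (Or.inl ⟨id, rfl, r, ha, hr⟩)))⟩
  · obtain ⟨a, h1, h2⟩ := AddRow.exists_meet hrs hs hr
    exact ⟨a, False, Or.inr (Or.inr (Or.inr (Or.inr ⟨id, r, s, hrs, h1, h2, hs, hr⟩)))⟩

theorem forward_unique (h : LocalRule a b c d m) (h' : LocalRule a b c d' m) : d = d' := by
  unfold LocalRule at h h'
  grind [AddRow.ne, AddRow.right_unique, AddRow.left_unique, AddRow.index_unique]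

theorem backward_unique (h : LocalRule a b c d m) (h' : LocalRule a' b c d m') :
    a = a' ∧ (m ↔ m') := by
  unfold LocalRule at h h'
  grind [AddRow.ne, AddRow.right_unique, AddRow.left_unique, AddRow.index_unique]

theorem addLeOne_south (h : LocalRule a b c d m) : AddLeOne a b := by
  unfold LocalRule AddLeOne at *
  grind

theorem addLeOne_west (h : LocalRule a b c d m) : AddLeOne a c := by
  unfold LocalRule AddLeOne at *
  grind

theorem addLeOne_north (h : LocalRule a b c d m) : AddLeOne c d := by
  unfold LocalRule AddLeOne at *
  grind

theorem addLeOne_east (h : LocalRule a b c d m) : AddLeOne b d := by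
  unfold LocalRule AddLeOne at *
  grind

theorem eq_of_mark (h : LocalRule a b c d m) (hm : m) : a = b ∧ a = c := by
  unfold LocalRule at *
  grind

theorem north_ne_iff (h : LocalRule a b c d m) : c ≠ d ↔ a ≠ b ∨ m := by
  unfold LocalRule at *
  grind [AddRow.ne]

theorem east_ne_iff (h : LocalRule a b c d m) : b ≠ d ↔ a ≠ c ∨ m := by
  unfold LocalRule at *
  grind [AddRow.ne]

theorem mark_iff (h : LocalRule a b c d m) : m ↔ b = c ∧ AddRow 0 b d := by
  unfold LocalRule at *
  grind [AddRow.ne, AddRow.index_unique]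

theorem rowLen_zero_of_mark (h : LocalRule a b c d m) (hm : m) :
    d.rowLen 0 = a.rowLen 0 + 1 := by
  have h1 := (h.mark_iff.1 hm).2 0
  rw [h1, (h.eq_of_mark hm).1]
  simp

theorem rowLen_zero_of_not_mark (h : LocalRule a b c d m) (hm : ¬ m) :
    d.rowLen 0 = b.rowLen 0 ∨ d.rowLen 0 = c.rowLen 0 := by
  rcases h with ⟨-, -, rfl, -⟩ | ⟨-, -, rfl, -⟩ | h | ⟨-, -, r, -, h⟩ | ⟨-, r, s, hrs, -, -, h1, h2⟩
  · exact Or.inr rfl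
  · exact Or.inl rfl
  · exact absurd h.1 hm
  · left; simpa using h 0
  · have := h1 0
    have := h2 0
    split_ifs at * <;> omega

variable {r : ℕ}

theorem south_of_north (h : LocalRule a b c d m) (h' : AddRow r c d) :
    AddRow r a b ∨ (b = c ∧ AddRow r b d) := by
  unfold LocalRule at *
  grind [AddRow.ne, AddRow.index_unique]

theorem west_of_east (h : LocalRule a b c d m) (h' : AddRow r b d) :
    AddRow r a c ∨ (b = c ∧ AddRow r b d) := by
  unfold LocalRule at *
  grind [AddRow.ne, AddRow.index_unique]

theorem eq_of_north_of_east (h' : AddRow r c d) (h'' : AddRow r b d) : b = c :=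
  h''.left_unique h'

theorem south_of_succ (h : LocalRule a b c d m) (h' : b = c) (h'' : AddRow (r + 1) b d) :
    AddRow r a b := by
  unfold LocalRule at *
  grind [AddRow.ne, AddRow.index_unique]

theorem north_of_south (h : LocalRule a b c d m) (h' : AddRow r a b) :
    AddRow r c d ∨ (b = c ∧ AddRow (r + 1) b d) := by
  unfold LocalRule at *
  grind [AddRow.ne, AddRow.index_unique]

theorem east_of_west (h : LocalRule a b c d m) (h' : AddRow r a c) :
    AddRow r b d ∨ (b = c ∧ AddRow (r + 1) b d) := by
  unfold LocalRule at *
  grind [AddRow.ne, AddRow.index_unique]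

theorem succ_of_south_of_west (h : LocalRule a b c d m) (h' : AddRow r a b) (h'' : AddRow r a c) :
    b = c ∧ AddRow (r + 1) b d := by
  unfold LocalRule at *
  grind [AddRow.ne, AddRow.index_unique, AddRow.right_unique]

end LocalRule

/-- A set of cells closed under moving down and to the left. -/
def IsDownShape (Y : ℕ → ℕ → Prop) : Prop :=
  ∀ i j i' j', Y i j → i' ≤ i → j' ≤ j → Y i' j'

/-- A relation on `ℕ` having at most one point in each row and in each column. -/
def IsPartialPerm (P : ℕ → ℕ → Prop) : Prop :=
  (∀ i j j', P i j → P i j' → j = j') ∧ ∀ i i' j, P i j → P i' j → i = i'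

/-- `G` labels the vertices of the grid so that every cell `(i, j)` of the shape `Y`, which has
corners `(i, j)` and `(i + 1, j + 1)`, satisfies the local rule for the filling `P`. -/
structure IsGrowth (Y P : ℕ → ℕ → Prop) (G : ℕ → ℕ → YoungDiagram) : Prop where
  south : ∀ i, G i 0 = ⊥
  west : ∀ j, G 0 j = ⊥
  rule : ∀ i j, Y i j →
    LocalRule (G i j) (G (i + 1) j) (G i (j + 1)) (G (i + 1) (j + 1)) (P i j)

namespace IsGrowth

variable {Y P P' : ℕ → ℕ → Prop} {G G' : ℕ → ℕ → YoungDiagram}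

theorem ne_right_iff (h : IsGrowth Y P G) {i j : ℕ} (hY : ∀ j' < j, Y i j') :
    G i j ≠ G (i + 1) j ↔ ∃ j' < j, P i j' := by
  induction j with
  | zero => simp [h.south]
  | succ j ih =>
    rw [(h.rule i j (hY j (by omega))).north_ne_iff, ih fun j' hj' => hY j' (by omega)]
    grind

theorem ne_up_iff (h : IsGrowth Y P G) {i j : ℕ} (hY : ∀ i' < i, Y i' j) :
    G i j ≠ G i (j + 1) ↔ ∃ i' < i, P i' j := by
  induction i with
  | zero => simp [h.west]
  | succ i ih =>
    rw [(h.rule i j (hY i (by omega))).east_ne_iff, ih fun i' hi' => hY i' (by omega)]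
    grind

theorem unique (hY : IsDownShape Y)
    (h : IsGrowth Y P G) (h' : IsGrowth Y P G') {i j : ℕ} (hij : Y (i - 1) (j - 1)) :
    G i j = G' i j := by
  induction hn : i + j using Nat.strong_induction_on generalizing i j with
  | _ n ih =>
    rcases i with _ | i
    · rw [h.west, h'.west]
    rcases j with _ | j
    · rw [h.south, h'.south]
    have h1 := h.rule i j hij
    have h2 := h'.rule i j hij
    rw [ih (i + j) (by omega) (hY _ _ _ _ hij (by omega) (by omega)) rfl,
      ih (i + 1 + j) (by omega) (hY _ _ _ _ hij (by omega) (by omega)) rfl,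
      ih (i + (j + 1)) (by omega) (hY _ _ _ _ hij (by omega) (by omega)) rfl] at h1
    exact h1.forward_unique h2

theorem unique_of_boundary (hYd : IsDownShape Y) (n : ℕ) (hYn : ∀ i j, Y i j → i < n ∧ j < n)
    (h : IsGrowth Y P G) (h' : IsGrowth Y P' G')
    (hG : ∀ i j, ¬ Y i j → Y (i - 1) (j - 1) → G i j = G' i j) {i j : ℕ}
    (hij : Y (i - 1) (j - 1)) : G i j = G' i j := by
  induction hm : 2 * n - (i + j) using Nat.strong_induction_on generalizing i j with
  | _ m ih =>
    by_cases hY : Y i j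
    · have := hYn i j hY
      have h1 := h.rule i j hY
      have h2 := h'.rule i j hY
      rw [ih (2 * n - (i + 1 + j)) (by omega) (hYd _ _ _ _ hY (by omega) (by omega)) rfl,
        ih (2 * n - (i + (j + 1))) (by omega) (hYd _ _ _ _ hY (by omega) (by omega)) rfl,
        ih (2 * n - (i + 1 + (j + 1))) (by omega) (hYd _ _ _ _ hY (by omega) (by omega)) rfl] at h1
      exact (h1.backward_unique h2).1
    · exact hG i j hY hij

end IsGrowth

open Classical in
/-- The growth diagram of a filling. -/
noncomputable def growth (P : ℕ → ℕ → Prop) : ℕ → ℕ → YoungDiagram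
  | 0, _ => ⊥
  | _ + 1, 0 => ⊥
  | i + 1, j + 1 =>
    if h : ∃ d, LocalRule (growth P i j) (growth P (i + 1) j) (growth P i (j + 1)) d (P i j) then
      h.choose
    else ⊥

theorem isGrowth_growth {P : ℕ → ℕ → Prop} (hP : IsPartialPerm P) :
    IsGrowth (fun _ _ => True) P (growth P) := by
  have h0 : ∀ i, growth P i 0 = ⊥ := fun i => by cases i <;> simp [growth]
  have h1 : ∀ j, growth P 0 j = ⊥ := fun j => by simp [growth]
  have key : ∀ i j,
      (AddLeOne (growth P i j) (growth P (i + 1) j) ∧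
        (growth P i j ≠ growth P (i + 1) j ↔ ∃ j' < j, P i j')) ∧
      (AddLeOne (growth P i j) (growth P i (j + 1)) ∧
        (growth P i j ≠ growth P i (j + 1) ↔ ∃ i' < i, P i' j)) →
      LocalRule (growth P i j) (growth P (i + 1) j) (growth P i (j + 1))
        (growth P (i + 1) (j + 1)) (P i j) := by
    rintro i j ⟨⟨h1, h2⟩, h3, h4⟩
    have := LocalRule.exists_forward h1 h3 (m := P i j) fun h => by
      constructor
      · by_contra h'
        obtain ⟨j', hj', h''⟩ := h2.1 h'
        exact hj'.ne (hP.1 _ _ _ h'' h)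
      · by_contra h'
        obtain ⟨j', hj', h''⟩ := h4.1 h'
        exact hj'.ne (hP.2 _ _ _ h'' h)
    have h5 : growth P (i + 1) (j + 1) = this.choose := by
      conv_lhs => rw [growth]
      rw [dif_pos this]
    rw [h5]
    exact this.choose_spec
  have edges : ∀ n i j, i + j = n →
      (AddLeOne (growth P i j) (growth P (i + 1) j) ∧
        (growth P i j ≠ growth P (i + 1) j ↔ ∃ j' < j, P i j')) ∧
      (AddLeOne (growth P i j) (growth P i (j + 1)) ∧
        (growth P i j ≠ growth P i (j + 1) ↔ ∃ i' < i, P i' j)) := by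
    intro n
    induction n with
    | zero =>
      intro i j hij
      obtain ⟨rfl, rfl⟩ : i = 0 ∧ j = 0 := by omega
      simp [h0, h1, AddLeOne]
    | succ n ih =>
      intro i j hij
      constructor
      · rcases j with _ | j
        · simp [h0, AddLeOne]
        · have h2 := ih i j (by omega)
          have h3 := key i j h2
          refine ⟨h3.addLeOne_north, ?_⟩
          rw [h3.north_ne_iff, h2.1.2]
          grind
      · rcases i with _ | i
        · simp [h1, AddLeOne]
        · have h2 := ih i j (by omega)
          have h3 := key i j h2
          refine ⟨h3.addLeOne_east, ?_⟩
          rw [h3.east_ne_iff, h2.2.2]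
          grind
  exact ⟨h0, h1, fun i j _ => key i j (edges _ i j rfl)⟩

theorem exists_isGrowth_of_boundary {Y : ℕ → ℕ → Prop} {B : ℕ → ℕ → YoungDiagram}
    (hYd : IsDownShape Y) (n : ℕ) (hYn : ∀ i j, Y i j → i < n ∧ j < n)
    (hB0 : ∀ i, B i 0 = ⊥) (hB1 : ∀ j, B 0 j = ⊥)
    (hBh : ∀ i j, AddLeOne (B i j) (B (i + 1) j)) (hBv : ∀ i j, AddLeOne (B i j) (B i (j + 1))) :
    ∃ P G, IsGrowth Y P G ∧ (∀ i j, P i j → Y i j) ∧ ∀ i j, ¬ Y i j → G i j = B i j := by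
  classical
  have key : ∀ m, ∃ G : ℕ → ℕ → YoungDiagram, (∀ i j, ¬ Y i j → G i j = B i j) ∧
      ∀ i j, Y i j → 2 * n ≤ i + j + m → ∃ p,
        LocalRule (G i j) (G (i + 1) j) (G i (j + 1)) (G (i + 1) (j + 1)) p := by
    intro m
    induction m with
    | zero =>
      refine ⟨B, fun _ _ _ => rfl, fun i j hij hn => ?_⟩
      have := hYn i j hij
      omega
    | succ m ih =>
      obtain ⟨G, hG, hr⟩ := ih
      have hex : ∀ i j, Y i j → i + j + (m + 1) = 2 * n → ∃ a p,
          LocalRule a (G (i + 1) j) (G i (j + 1)) (G (i + 1) (j + 1)) p := by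
        intro i j hij hn
        apply LocalRule.exists_backward
        · by_cases h : Y (i + 1) j
          · obtain ⟨p, hp⟩ := hr _ _ h (by omega)
            exact hp.addLeOne_west
          · rw [hG _ _ h, hG _ _ fun h' => h (hYd _ _ _ _ h' (by omega) (by omega))]
            exact hBv _ _
        · by_cases h : Y i (j + 1)
          · obtain ⟨p, hp⟩ := hr _ _ h (by omega)
            exact hp.addLeOne_south
          · rw [hG _ _ h, hG _ _ fun h' => h (hYd _ _ _ _ h' (by omega) (by omega))]
            exact hBh _ _
      choose! a ha using hex
      refine ⟨fun i j => if Y i j ∧ i + j + (m + 1) = 2 * n then a i j else G i j,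
        fun i j hij => ?_, fun i j hij hn => ?_⟩
      · simp [hij, hG i j hij]
      · have h1 : ¬ i + 1 + j + (m + 1) = 2 * n := by omega
        have h2 : ¬ i + (j + 1) + (m + 1) = 2 * n := by omega
        have h3 : ¬ i + 1 + (j + 1) + (m + 1) = 2 * n := by omega
        simp only [h1, h2, h3, and_false, if_false]
        by_cases h : i + j + (m + 1) = 2 * n
        · rw [if_pos ⟨hij, h⟩]
          exact ha i j hij h
        · rw [if_neg (by omega)]
          exact hr i j hij (by omega)
  obtain ⟨G, hG, hr⟩ := key (2 * n)
  have hr' : ∀ i j, Y i j → ∃ p,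
      LocalRule (G i j) (G (i + 1) j) (G i (j + 1)) (G (i + 1) (j + 1)) p :=
    fun i j hij => hr i j hij (by omega)
  have hGh : ∀ i j, AddLeOne (G i j) (G (i + 1) j) := by
    intro i j
    by_cases h : Y i j
    · obtain ⟨p, hp⟩ := hr' i j h
      exact hp.addLeOne_south
    · rw [hG _ _ h, hG _ _ fun h' => h (hYd _ _ _ _ h' (by omega) (by omega))]
      exact hBh _ _
  have hGv : ∀ i j, AddLeOne (G i j) (G i (j + 1)) := by
    intro i j
    by_cases h : Y i j
    · obtain ⟨p, hp⟩ := hr' i j h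
      exact hp.addLeOne_west
    · rw [hG _ _ h, hG _ _ fun h' => h (hYd _ _ _ _ h' (by omega) (by omega))]
      exact hBv _ _
  have hG0 : ∀ d i, n ≤ i + d → G i 0 = ⊥ := by
    intro d
    induction d with
    | zero =>
      intro i hi
      rw [hG i 0 fun h => by have := hYn _ _ h; omega, hB0]
    | succ d ih =>
      intro i hi
      have := hGh i 0
      rw [ih (i + 1) (by omega)] at this
      exact this.eq_bot
  have hG1 : ∀ d j, n ≤ j + d → G 0 j = ⊥ := by
    intro d
    induction d with
    | zero =>
      intro j hj
      rw [hG 0 j fun h => by have := hYn _ _ h; omega, hB1]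
    | succ d ih =>
      intro j hj
      have := hGv 0 j
      rw [ih (j + 1) (by omega)] at this
      exact this.eq_bot
  choose! p hp using hr'
  refine ⟨fun i j => Y i j ∧ p i j, G, ⟨fun i => hG0 n i (by omega), fun j => hG1 n j (by omega),
    fun i j hij => ?_⟩, fun i j h => h.1, hG⟩
  simpa only [hij, true_and] using hp i j hij

theorem IsGrowth.mono {Y P : ℕ → ℕ → Prop} {G : ℕ → ℕ → YoungDiagram}
    (h : IsGrowth (fun _ _ => True) P G) : IsGrowth Y P G :=
  ⟨h.south, h.west, fun i j _ => h.rule i j trivial⟩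

theorem IsGrowth.isPartialPerm {Y P : ℕ → ℕ → Prop} {G : ℕ → ℕ → YoungDiagram}
    (hYd : IsDownShape Y) (h : IsGrowth Y P G) (hP : ∀ i j, P i j → Y i j) : IsPartialPerm P := by
  have h1 : ∀ i j j', P i j → P i j' → ¬ j < j' := fun i j j' hj hj' hlt =>
    (h.ne_right_iff fun j'' hj'' => hYd _ _ _ _ (hP _ _ hj') le_rfl hj''.le).2 ⟨j, hlt, hj⟩
      ((h.rule i j' (hP _ _ hj')).eq_of_mark hj').1
  have h2 : ∀ i i' j, P i j → P i' j → ¬ i < i' := fun i i' j hi hi' hlt =>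
    (h.ne_up_iff fun i'' hi'' => hYd _ _ _ _ (hP _ _ hi') hi''.le le_rfl).2 ⟨i, hlt, hi⟩
      ((h.rule i' j (hP _ _ hi')).eq_of_mark hi').2
  refine ⟨fun i j j' hj hj' => ?_, fun i i' j hi hi' => ?_⟩
  · have := h1 i j j' hj hj'
    have := h1 i j' j hj' hj
    omega
  · have := h2 i i' j hi hi'
    have := h2 i' i j hi' hi
    omega

/-- The boundary labels of `P'` are the transposes of those of `P`. -/
def IsTransfer (Y P P' : ℕ → ℕ → Prop) : Prop :=
  ∀ i j, ¬ Y i j → Y (i - 1) (j - 1) → growth P' i j = (growth P i j).transpose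

theorem exists_isTransfer {Y P : ℕ → ℕ → Prop} (hYd : IsDownShape Y) (n : ℕ)
    (hYn : ∀ i j, Y i j → i < n ∧ j < n) (hP : IsPartialPerm P) :
    ∃ P', IsPartialPerm P' ∧ (∀ i j, P' i j → Y i j) ∧ IsTransfer Y P P' := by
  have hg := isGrowth_growth hP
  obtain ⟨P', H, h1, h2, h3⟩ := exists_isGrowth_of_boundary hYd n hYn
    (B := fun i j => (growth P i j).transpose)
    (fun i => by rw [hg.south]; rfl) (fun j => by rw [hg.west]; rfl)
    (fun i j => (hg.rule i j trivial).addLeOne_south.transpose)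
    (fun i j => (hg.rule i j trivial).addLeOne_west.transpose)
  have h4 := h1.isPartialPerm hYd h2
  refine ⟨P', h4, h2, fun i j hij hij' => ?_⟩
  rw [(isGrowth_growth h4).mono.unique hYd h1 hij', h3 i j hij]

namespace IsTransfer

variable {Y P P' Q : ℕ → ℕ → Prop} {n : ℕ}

theorem exists_row_iff (h : IsTransfer Y P P') (hYd : IsDownShape Y)
    (hYn : ∀ i j, Y i j → i < n ∧ j < n) (hP : IsPartialPerm P) (hPY : ∀ i j, P i j → Y i j)
    (hP' : IsPartialPerm P') (hPY' : ∀ i j, P' i j → Y i j) (i : ℕ) :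
    (∃ j, P i j) ↔ ∃ j, P' i j := by
  classical
  have hex : ∃ j, ¬ Y i j := ⟨n, fun h => by have := hYn _ _ h; omega⟩
  obtain ⟨j, hj, hmin⟩ : ∃ j, ¬ Y i j ∧ ∀ j' < j, Y i j' :=
    ⟨Nat.find hex, Nat.find_spec hex, fun j' hj' => not_not.1 (Nat.find_min hex hj')⟩
  have hlt : ∀ j', Y i j' → j' < j := fun j' hj' =>
    Nat.lt_of_not_le fun hle => hj (hYd _ _ _ _ hj' le_rfl hle)
  rcases j with _ | j
  · constructor <;> rintro ⟨j', hj'⟩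
    · exact absurd (hlt _ (hPY _ _ hj')) (by omega)
    · exact absurd (hlt _ (hPY' _ _ hj')) (by omega)
  have e1 : (∃ j, P i j) ↔ ∃ j' < j + 1, P i j' :=
    ⟨fun ⟨j', hj'⟩ => ⟨j', hlt _ (hPY _ _ hj'), hj'⟩, fun ⟨j', _, hj'⟩ => ⟨j', hj'⟩⟩
  have e2 : (∃ j, P' i j) ↔ ∃ j' < j + 1, P' i j' :=
    ⟨fun ⟨j', hj'⟩ => ⟨j', hlt _ (hPY' _ _ hj'), hj'⟩, fun ⟨j', _, hj'⟩ => ⟨j', hj'⟩⟩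
  rw [e1, e2, ← (isGrowth_growth hP).ne_right_iff fun _ _ => trivial,
    ← (isGrowth_growth hP').ne_right_iff fun _ _ => trivial,
    h i (j + 1) hj (hYd _ _ _ _ (hmin j (by omega)) (by omega) (by omega)),
    h (i + 1) (j + 1) (fun h' => hj (hYd _ _ _ _ h' (by omega) (by omega)))
      (hmin j (by omega)), ne_eq, ne_eq, YoungDiagram.transpose_eq_iff]

theorem exists_col_iff (h : IsTransfer Y P P') (hYd : IsDownShape Y)
    (hYn : ∀ i j, Y i j → i < n ∧ j < n) (hP : IsPartialPerm P) (hPY : ∀ i j, P i j → Y i j)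
    (hP' : IsPartialPerm P') (hPY' : ∀ i j, P' i j → Y i j) (j : ℕ) :
    (∃ i, P i j) ↔ ∃ i, P' i j := by
  classical
  have hex : ∃ i, ¬ Y i j := ⟨n, fun h => by have := hYn _ _ h; omega⟩
  obtain ⟨i, hi, hmin⟩ : ∃ i, ¬ Y i j ∧ ∀ i' < i, Y i' j :=
    ⟨Nat.find hex, Nat.find_spec hex, fun i' hi' => not_not.1 (Nat.find_min hex hi')⟩
  have hlt : ∀ i', Y i' j → i' < i := fun i' hi' =>
    Nat.lt_of_not_le fun hle => hi (hYd _ _ _ _ hi' hle le_rfl)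
  rcases i with _ | i
  · constructor <;> rintro ⟨i', hi'⟩
    · exact absurd (hlt _ (hPY _ _ hi')) (by omega)
    · exact absurd (hlt _ (hPY' _ _ hi')) (by omega)
  have e1 : (∃ i, P i j) ↔ ∃ i' < i + 1, P i' j :=
    ⟨fun ⟨i', hi'⟩ => ⟨i', hlt _ (hPY _ _ hi'), hi'⟩, fun ⟨i', _, hi'⟩ => ⟨i', hi'⟩⟩
  have e2 : (∃ i, P' i j) ↔ ∃ i' < i + 1, P' i' j :=
    ⟨fun ⟨i', hi'⟩ => ⟨i', hlt _ (hPY' _ _ hi'), hi'⟩, fun ⟨i', _, hi'⟩ => ⟨i', hi'⟩⟩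
  rw [e1, e2, ← (isGrowth_growth hP).ne_up_iff fun _ _ => trivial,
    ← (isGrowth_growth hP').ne_up_iff fun _ _ => trivial,
    h (i + 1) j hi (hYd _ _ _ _ (hmin i (by omega)) (by omega) (by omega)),
    h (i + 1) (j + 1) (fun h' => hi (hYd _ _ _ _ h' (by omega) (by omega)))
      (hmin i (by omega)), ne_eq, ne_eq, YoungDiagram.transpose_eq_iff]

theorem left_unique (h : IsTransfer Y P P') (h' : IsTransfer Y Q P') (hYd : IsDownShape Y)
    (hYn : ∀ i j, Y i j → i < n ∧ j < n) (hP : IsPartialPerm P) (hQ : IsPartialPerm Q)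
    {i j : ℕ} (hij : Y i j) : P i j ↔ Q i j := by
  have hP1 : IsGrowth Y P (growth P) := (isGrowth_growth hP).mono
  have hQ1 : IsGrowth Y Q (growth Q) := (isGrowth_growth hQ).mono
  have hG : ∀ {i j}, Y (i - 1) (j - 1) → growth P i j = growth Q i j :=
    hP1.unique_of_boundary hYd n hYn hQ1 fun i j h1 h2 => by
      rw [← YoungDiagram.transpose_eq_iff, ← h i j h1 h2, ← h' i j h1 h2]
  have h1 := hP1.rule i j hij
  rw [hG (hYd _ _ _ _ hij (by omega) (by omega)), hG (hYd _ _ _ _ hij (by omega) (by omega)),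
    hG (hYd _ _ _ _ hij (by omega) (by omega)), hG (hYd _ _ _ _ hij (by omega) (by omega))] at h1
  exact (h1.backward_unique (hQ1.rule i j hij)).2

end IsTransfer

/-- `P` has a chain of `m` points, increasing in both coordinates, inside `[0, x) × [0, y)`. -/
def IncChain (P : ℕ → ℕ → Prop) : ℕ → ℕ → ℕ → Prop
  | 0, _, _ => True
  | m + 1, x, y => ∃ i j, i < x ∧ j < y ∧ P i j ∧ IncChain P m i j

/-- `P` has a chain of `m` points, increasing in the first and decreasing in the second coordinate,
inside `[0, x) × [b, y)`. -/
def DecChain (P : ℕ → ℕ → Prop) : ℕ → ℕ → ℕ → ℕ → Prop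
  | 0, _, _, _ => True
  | m + 1, x, b, y => ∃ i j, i < x ∧ b ≤ j ∧ j < y ∧ P i j ∧ DecChain P m i (j + 1) y

theorem IncChain.mono {P P' : ℕ → ℕ → Prop} {m x x' y y' : ℕ} (h : IncChain P m x y)
    (hx : x ≤ x') (hy : y ≤ y') (hP : ∀ i j, i < x → j < y → P i j → P' i j) :
    IncChain P' m x' y' := by
  induction m generalizing x y x' y' with
  | zero => trivial
  | succ m ih =>
    obtain ⟨i, j, hi, hj, hij, h⟩ := h
    exact ⟨i, j, by omega, by omega, hP i j hi hj hij,
      ih h le_rfl le_rfl fun i' j' _ _ => hP i' j' (by omega) (by omega)⟩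

theorem DecChain.mono {P P' : ℕ → ℕ → Prop} {m x x' b b' y y' : ℕ} (h : DecChain P m x b y)
    (hx : x ≤ x') (hb : b' ≤ b) (hy : y ≤ y')
    (hP : ∀ i j, i < x → j < y → P i j → P' i j) : DecChain P' m x' b' y' := by
  induction m generalizing x b x' b' with
  | zero => trivial
  | succ m ih =>
    obtain ⟨i, j, hi, hb, hj, hij, h⟩ := h
    exact ⟨i, j, by omega, by omega, by omega, hP i j hi hj hij,
      ih h le_rfl le_rfl fun i' j' _ hj' => hP i' j' (by omega) hj'⟩

/-- The points of the `r`-th iterated skeleton (in the sense of Viennot) of the filling whose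
growth diagram is `G`. -/
def Skeleton (G : ℕ → ℕ → YoungDiagram) (r i j : ℕ) : Prop :=
  G (i + 1) j = G i (j + 1) ∧ AddRow r (G (i + 1) j) (G (i + 1) (j + 1))

namespace IsGrowth

variable {P : ℕ → ℕ → Prop} {G : ℕ → ℕ → YoungDiagram}

theorem rowLen_mono (h : IsGrowth (fun _ _ => True) P G) {i i' j j' : ℕ} (hi : i ≤ i')
    (hj : j ≤ j') (s : ℕ) : (G i j).rowLen s ≤ (G i' j').rowLen s :=
  (monotone_nat_of_le_succ (f := fun t => (G t j).rowLen s)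
    (fun t => (h.rule t j trivial).addLeOne_south.rowLen_le s) hi).trans
  (monotone_nat_of_le_succ (f := fun t => (G i' t).rowLen s)
    (fun t => (h.rule i' t trivial).addLeOne_west.rowLen_le s) hj)

theorem skeleton_zero (h : IsGrowth (fun _ _ => True) P G) : Skeleton G 0 = P := by
  ext i j
  exact (h.rule i j trivial).mark_iff.symm

theorem rowLen_bot (s : ℕ) : (⊥ : YoungDiagram).rowLen s = 0 := by
  by_contra h
  exact YoungDiagram.notMem_bot (s, 0)
    ((YoungDiagram.mem_iff_lt_rowLen).2 (Nat.pos_of_ne_zero h))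

theorem incChain_iff (h : IsGrowth (fun _ _ => True) P G) (m x y : ℕ) :
    IncChain P m x y ↔ m ≤ (G x y).rowLen 0 := by
  constructor
  · intro hc
    induction m generalizing x y with
    | zero => omega
    | succ m ih =>
      obtain ⟨i, j, hi, hj, hij, hc⟩ := hc
      have h1 := ih i j hc
      have h2 := (h.rule i j trivial).rowLen_zero_of_mark hij
      have h3 := h.rowLen_mono (Nat.succ_le_of_lt hi) (Nat.succ_le_of_lt hj) 0
      simp only [Nat.succ_eq_add_one] at h3
      omega
  · induction hn : x + y using Nat.strong_induction_on generalizing m x y with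
    | _ n ih =>
      intro hm
      rcases m with _ | m
      · trivial
      rcases x with _ | x
      · rw [h.west, rowLen_bot] at hm; omega
      rcases y with _ | y
      · rw [h.south, rowLen_bot] at hm; omega
      by_cases hP : P x y
      · rw [(h.rule x y trivial).rowLen_zero_of_mark hP] at hm
        exact ⟨x, y, by omega, by omega, hP, ih (x + y) (by omega) m x y rfl (by omega)⟩
      · rcases (h.rule x y trivial).rowLen_zero_of_not_mark hP with h' | h' <;> rw [h'] at hm
        · exact (ih (x + 1 + y) (by omega) _ _ _ rfl hm).mono (by omega) (by omega)
            fun _ _ _ _ => id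
        · exact (ih (x + (y + 1)) (by omega) _ _ _ rfl hm).mono (by omega) (by omega)
            fun _ _ _ _ => id

variable {r : ℕ}

theorem exists_skeleton_below (h : IsGrowth (fun _ _ => True) P G) {i j b : ℕ} (hb : b ≤ j)
    (hj : AddRow r (G i j) (G (i + 1) j)) :
    AddRow r (G i b) (G (i + 1) b) ∨ ∃ j', b ≤ j' ∧ j' < j ∧ Skeleton G r i j' := by
  induction j, hb using Nat.le_induction with
  | base => exact Or.inl hj
  | succ j hb ih =>
    rcases (h.rule i j trivial).south_of_north hj with h' | h'
    · rcases ih h' with h' | ⟨j', h1, h2, h3⟩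
      · exact Or.inl h'
      · exact Or.inr ⟨j', h1, by omega, h3⟩
    · exact Or.inr ⟨j, hb, by omega, h'⟩

theorem exists_skeleton_left (h : IsGrowth (fun _ _ => True) P G) {i j b : ℕ} (hb : b ≤ i)
    (hi : AddRow r (G i j) (G i (j + 1))) :
    AddRow r (G b j) (G b (j + 1)) ∨ ∃ i', b ≤ i' ∧ i' < i ∧ Skeleton G r i' j := by
  induction i, hb using Nat.le_induction with
  | base => exact Or.inl hi
  | succ i hb ih =>
    rcases (h.rule i j trivial).west_of_east hi with h' | h'
    · rcases ih h' with h' | ⟨i', h1, h2, h3⟩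
      · exact Or.inl h'
      · exact Or.inr ⟨i', h1, by omega, h3⟩
    · exact Or.inr ⟨i, hb, by omega, h'⟩

theorem exists_skeleton_succ_above (h : IsGrowth (fun _ _ => True) P G) {i j t : ℕ} (ht : j ≤ t)
    (hj : AddRow r (G i j) (G (i + 1) j)) :
    AddRow r (G i t) (G (i + 1) t) ∨ ∃ j', j ≤ j' ∧ j' < t ∧ Skeleton G (r + 1) i j' := by
  induction t, ht using Nat.le_induction with
  | base => exact Or.inl hj
  | succ t ht ih =>
    rcases ih with h' | ⟨j', h1, h2, h3⟩
    · rcases (h.rule i t trivial).north_of_south h' with h' | h'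
      · exact Or.inl h'
      · exact Or.inr ⟨t, ht, by omega, h'⟩
    · exact Or.inr ⟨j', h1, by omega, h3⟩

theorem exists_skeleton_succ_right (h : IsGrowth (fun _ _ => True) P G) {i j t : ℕ} (ht : i ≤ t)
    (hi : AddRow r (G i j) (G i (j + 1))) :
    AddRow r (G t j) (G t (j + 1)) ∨ ∃ i', i ≤ i' ∧ i' < t ∧ Skeleton G (r + 1) i' j := by
  induction t, ht using Nat.le_induction with
  | base => exact Or.inl hi
  | succ t ht ih =>
    rcases ih with h' | ⟨i', h1, h2, h3⟩
    · rcases (h.rule t j trivial).east_of_west h' with h' | h'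
      · exact Or.inl h'
      · exact Or.inr ⟨t, ht, by omega, h'⟩
    · exact Or.inr ⟨i', h1, by omega, h3⟩

theorem exists_skeleton_succ_between (h : IsGrowth (fun _ _ => True) P G) {i i' j j' : ℕ}
    (hi : i < i') (hj : j' < j) (h1 : Skeleton G r i j) (h2 : Skeleton G r i' j') :
    ∃ u v, i < u ∧ u ≤ i' ∧ j' < v ∧ v ≤ j ∧ Skeleton G (r + 1) u v := by
  have e1 : AddRow r (G (i + 1) j) (G (i + 1) (j + 1)) := h1.2
  have e2 : AddRow r (G i' (j' + 1)) (G (i' + 1) (j' + 1)) := by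
    rw [← h2.1]
    exact h2.2
  rcases h.exists_skeleton_succ_right (Nat.succ_le_of_lt hi) e1 with h3 | ⟨u, h3, h4, h5⟩
  · rcases h.exists_skeleton_succ_above (Nat.succ_le_of_lt hj) e2 with h4 | ⟨v, h6, h7, h8⟩
    · exact ⟨i', j, hi, le_rfl, hj, le_rfl,
        (h.rule i' j trivial).succ_of_south_of_west h4 h3⟩
    · exact ⟨i', v, hi, le_rfl, h6, h7.le, h8⟩
  · exact ⟨u, j, h3, h4.le, hj, le_rfl, h5⟩

theorem exists_skeleton_between (h : IsGrowth (fun _ _ => True) P G) {i i' j j' : ℕ}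
    (hi : i < i') (hj : j' < j) (h1 : Skeleton G (r + 1) i j) (h2 : Skeleton G (r + 1) i' j') :
    ∃ u v, i ≤ u ∧ u < i' ∧ j' ≤ v ∧ v < j ∧ Skeleton G r u v := by
  have e1 : AddRow r (G i j) (G (i + 1) j) := (h.rule i j trivial).south_of_succ h1.1 h1.2
  have e2 : AddRow r (G i' j') (G i' (j' + 1)) := by
    have := (h.rule i' j' trivial).south_of_succ h2.1 h2.2
    rwa [h2.1] at this
  rcases h.exists_skeleton_below (Nat.succ_le_of_lt hj) e1 with h3 | ⟨v, h3, h4, h5⟩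
  · rcases h.exists_skeleton_left (Nat.succ_le_of_lt hi) e2 with h4 | ⟨u, h6, h7, h8⟩
    · exact ⟨i, j', le_rfl, hi, le_rfl, hj,
        LocalRule.eq_of_north_of_east h3 h4, h4⟩
    · exact ⟨u, j', Nat.le_of_succ_le h6, h7, le_rfl, hj, h8⟩
  · exact ⟨i, v, le_rfl, hi, Nat.le_of_succ_le h3, h4, h5⟩

theorem decChain_skeleton_iff (h : IsGrowth (fun _ _ => True) P G) (m x y : ℕ) :
    DecChain (Skeleton G r) (m + 2) x 0 y ↔ DecChain (Skeleton G (r + 1)) (m + 1) x 0 y := by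
  have down : ∀ m i j, Skeleton G r i j → j < y → DecChain (Skeleton G r) m i (j + 1) y →
      DecChain (Skeleton G (r + 1)) m (i + 1) (j + 1) y := by
    intro m
    induction m with
    | zero => intros; trivial
    | succ m ih =>
      rintro i j hij hj ⟨i', j', hi', hb, hj', hij', hc⟩
      obtain ⟨u, v, hu, hu', hv, hv', huv⟩ := h.exists_skeleton_succ_between hi' hb hij' hij
      exact ⟨u, v, by omega, by omega, by omega, huv,
        (ih i' j' hij' hj' hc).mono (by omega) (by omega) le_rfl fun _ _ _ _ => id⟩
  have up : ∀ m i j, Skeleton G (r + 1) i j → j < y →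
      DecChain (Skeleton G (r + 1)) m i (j + 1) y → DecChain (Skeleton G r) (m + 1) i j y := by
    intro m
    induction m with
    | zero =>
      intro i j hij hj _
      have := (h.rule i j trivial).south_of_succ hij.1 hij.2
      rw [hij.1] at this
      rcases h.exists_skeleton_left (Nat.zero_le i) this with h' | ⟨u, -, hu, h'⟩
      · rw [h.west, h.west] at h'
        exact absurd rfl h'.ne
      · exact ⟨u, j, hu, le_rfl, hj, h', trivial⟩
    | succ m ih =>
      rintro i j hij hj ⟨i', j', hi', hb, hj', hij', hc⟩
      obtain ⟨u, v, hu, hu', hv, hv', huv⟩ := h.exists_skeleton_between hi' hb hij' hij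
      exact ⟨u, v, by omega, by omega, by omega, huv,
        (ih i' j' hij' hj' hc).mono (by omega) (by omega) le_rfl fun _ _ _ _ => id⟩
  constructor
  · rintro ⟨i, j, hi, -, hj, hij, hc⟩
    exact (down (m + 1) i j hij hj hc).mono (by omega) (by omega) le_rfl fun _ _ _ _ => id
  · rintro ⟨i, j, hi, -, hj, hij, hc⟩
    have hs := (h.rule i j trivial).south_of_succ hij.1 hij.2
    rcases h.exists_skeleton_below (Nat.zero_le j) hs with h' | ⟨v, -, hv, h'⟩
    · rw [h.south, h.south] at h'
      exact absurd rfl h'.ne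
    · exact ⟨i, v, hi, by omega, by omega, h',
        (up m i j hij hj hc).mono le_rfl (by omega) le_rfl fun _ _ _ _ => id⟩

theorem exists_skeleton_iff (h : IsGrowth (fun _ _ => True) P G) (x y : ℕ) :
    DecChain (Skeleton G r) 1 x 0 y ↔ 0 < (G x y).rowLen r := by
  constructor
  · rintro ⟨i, j, hi, -, hj, hij, -⟩
    have h1 := hij.2 r
    have h2 := h.rowLen_mono (Nat.succ_le_of_lt hi) (Nat.succ_le_of_lt hj) r
    simp only [Nat.succ_eq_add_one, if_true] at h1 h2
    omega
  · induction x with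
    | zero => simp [h.west, rowLen_bot]
    | succ x ih =>
      intro hpos
      have hmono : DecChain (Skeleton G r) 1 x 0 y → DecChain (Skeleton G r) 1 (x + 1) 0 y :=
        fun h' => h'.mono (by omega) le_rfl le_rfl fun _ _ _ _ => id
      by_cases h0 : 0 < (G x y).rowLen r
      · exact hmono (ih h0)
      rcases (h.rule x y trivial).addLeOne_south with h' | ⟨s, h'⟩
      · rw [h'] at h0
        exact absurd hpos h0
      · have h1 := h' r
        split_ifs at h1 with hs
        · subst hs
          rcases h.exists_skeleton_below (Nat.zero_le y) h' with h' | ⟨j, -, hj, h'⟩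
          · rw [h.south, h.south] at h'
            exact absurd rfl h'.ne
          · exact ⟨x, j, by omega, by omega, hj, h', trivial⟩
        · omega

theorem decChain_skeleton_iff_rowLen (h : IsGrowth (fun _ _ => True) P G) (m r x y : ℕ) :
    DecChain (Skeleton G r) (m + 1) x 0 y ↔ 0 < (G x y).rowLen (r + m) := by
  induction m generalizing r with
  | zero => exact h.exists_skeleton_iff x y
  | succ m ih => rw [h.decChain_skeleton_iff, ih, Nat.add_right_comm, Nat.add_assoc]

theorem decChain_iff (h : IsGrowth (fun _ _ => True) P G) (m x y : ℕ) :
    DecChain P m x 0 y ↔ m ≤ (G x y).colLen 0 := by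
  rcases m with _ | m
  · simp [DecChain]
  · have := h.decChain_skeleton_iff_rowLen m 0 x y
    rw [h.skeleton_zero, zero_add, ← YoungDiagram.mem_iff_lt_rowLen,
      YoungDiagram.mem_iff_lt_colLen] at this
    exact this

end IsGrowth

theorem IsTransfer.exists_incChain_iff {Y P P' : ℕ → ℕ → Prop} {n : ℕ} (h : IsTransfer Y P P')
    (hYn : ∀ i j, Y i j → i < n ∧ j < n) (hP : IsPartialPerm P) (hP' : IsPartialPerm P') (k : ℕ) :
    (∃ i j, Y i j ∧ IncChain P k (i + 1) (j + 1)) ↔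
      ∃ i j, Y i j ∧ DecChain P' k (i + 1) 0 (j + 1) := by
  classical
  have push : ∀ i j, Y i j → ∃ t, Y (i + t) (j + t) ∧ ¬ Y (i + t + 1) (j + t + 1) := by
    intro i j hij
    by_contra! hcon
    have : ∀ t, Y (i + t) (j + t) := by
      intro t
      induction t with
      | zero => exact hij
      | succ t ih => exact hcon t ih
    have := hYn _ _ (this n)
    omega
  have key : ∀ i j, Y i j → ¬ Y (i + 1) (j + 1) →
      (IncChain P k (i + 1) (j + 1) ↔ DecChain P' k (i + 1) 0 (j + 1)) := by
    intro i j h1 h2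
    rw [(isGrowth_growth hP).incChain_iff, (isGrowth_growth hP').decChain_iff, h _ _ h2 h1,
      YoungDiagram.colLen_transpose]
  constructor <;> rintro ⟨i, j, hij, hc⟩ <;> obtain ⟨t, h1, h2⟩ := push i j hij
  · exact ⟨_, _, h1, (key _ _ h1 h2).1
      (hc.mono (by omega) (by omega) fun _ _ _ _ => id)⟩
  · exact ⟨_, _, h1, (key _ _ h1 h2).2
      (hc.mono (by omega) le_rfl (by omega) fun _ _ _ _ => id)⟩

theorem IsPartialPerm.mono {P Q : ℕ → ℕ → Prop} (hP : IsPartialPerm P)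
    (h : ∀ i j, Q i j → P i j) : IsPartialPerm Q :=
  ⟨fun i j j' hj hj' => hP.1 i j j' (h _ _ hj) (h _ _ hj'),
    fun i i' j hi hi' => hP.2 i i' j (h _ _ hi) (h _ _ hi')⟩

theorem incChain_iff_exists {P : ℕ → ℕ → Prop} (m x y : ℕ) :
    IncChain P m x y ↔ ∃ f g : ℕ → ℕ, (∀ p < m, P (f p) (g p) ∧ f p < x ∧ g p < y) ∧
      ∀ p q, p < q → q < m → f p < f q ∧ g p < g q := by
  induction m generalizing x y with
  | zero => simp [IncChain]
  | succ m ih =>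
    constructor
    · rintro ⟨i, j, hi, hj, hij, hc⟩
      obtain ⟨f, g, h1, h2⟩ := (ih i j).1 hc
      refine ⟨fun p => if p = m then i else f p, fun p => if p = m then j else g p,
        fun p hp => ?_, fun p q hpq hq => ?_⟩ <;> grind
    · rintro ⟨f, g, h1, h2⟩
      have h3 := h1 m (by omega)
      refine ⟨f m, g m, h3.2.1, h3.2.2, h3.1, (ih _ _).2 ⟨f, g, fun p hp => ?_, fun p q hpq hq => ?_⟩⟩
      · exact ⟨(h1 p (by omega)).1, h2 p m hp (by omega)⟩
      · exact h2 p q hpq (by omega)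

theorem decChain_iff_exists {P : ℕ → ℕ → Prop} (m x b y : ℕ) :
    DecChain P m x b y ↔ ∃ f g : ℕ → ℕ,
      (∀ p < m, P (f p) (g p) ∧ f p < x ∧ b ≤ g p ∧ g p < y) ∧
      ∀ p q, p < q → q < m → f p < f q ∧ g q < g p := by
  induction m generalizing x b with
  | zero => simp [DecChain]
  | succ m ih =>
    constructor
    · rintro ⟨i, j, hi, hb, hj, hij, hc⟩
      obtain ⟨f, g, h1, h2⟩ := (ih i (j + 1)).1 hc
      refine ⟨fun p => if p = m then i else f p, fun p => if p = m then j else g p,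
        fun p hp => ?_, fun p q hpq hq => ?_⟩
      · by_cases h : p = m
        · simpa only [h, if_true] using ⟨hij, hi, hb, hj⟩
        · have h3 := h1 p (by omega)
          simp only [h, if_false]
          exact ⟨h3.1, by omega, by omega, h3.2.2.2⟩
      · have hp : p ≠ m := by omega
        have h3 := h1 p (by omega)
        by_cases h : q = m
        · simp only [h, hp, if_true, if_false]
          omega
        · simp only [h, hp, if_false]
          exact h2 p q hpq (by omega)
    · rintro ⟨f, g, h1, h2⟩
      have h3 := h1 m (by omega)
      refine ⟨f m, g m, h3.2.1, h3.2.2.1, h3.2.2.2, h3.1,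
        (ih _ _).2 ⟨f, g, fun p hp => ?_, fun p q hpq hq => ?_⟩⟩
      · have h4 := h1 p (by omega)
        have h5 := h2 p m hp (by omega)
        exact ⟨h4.1, h5.1, h5.2, h4.2.2.2⟩
      · exact h2 p q hpq (by omega)

/-- The points `(f p, g p)` of `P`, for `a ≤ p < b`, form an occurrence of the word
`s a, …, s (b - 1)`. -/
def IsOccurrence (s : ℕ → ℕ) (a b : ℕ) (P : ℕ → ℕ → Prop) (f g : ℕ → ℕ) : Prop :=
  (∀ p, a ≤ p → p < b → P (f p) (g p)) ∧
    ∀ p q, a ≤ p → p < q → q < b → f p < f q ∧ (g p < g q ↔ s p < s q)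

/-- The cells of the `n × n` square having an occurrence of `s k, …, s (l - 1)` strictly to their
north-east. -/
def OccurrenceShape (n : ℕ) (s : ℕ → ℕ) (k l : ℕ) (P : ℕ → ℕ → Prop) (i j : ℕ) : Prop :=
  i < n ∧ j < n ∧ ∃ f g, IsOccurrence s k l P f g ∧ ∀ p, k ≤ p → p < l → i < f p ∧ j < g p

section Shape

variable {n k l : ℕ} {s s' : ℕ → ℕ} {P P' : ℕ → ℕ → Prop}

theorem isDownShape_occurrenceShape : IsDownShape (OccurrenceShape n s k l P) := by
  rintro i j i' j' ⟨hi, hj, f, g, h1, h2⟩ hi' hj'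
  refine ⟨by omega, by omega, f, g, h1, fun p hp hp' => ?_⟩
  have := h2 p hp hp'
  omega

theorem occurrenceShape_congr (hs : ∀ p, k ≤ p → p < l → s p = s' p) :
    OccurrenceShape n s k l P = OccurrenceShape n s' k l P := by
  have h : ∀ f g, IsOccurrence s k l P f g ↔ IsOccurrence s' k l P f g := by
    intro f g
    refine and_congr Iff.rfl (forall₂_congr fun p q => forall₃_congr fun hp hpq hq => ?_)
    rw [hs p hp (by omega), hs q (by omega) hq]
  ext i j
  simp only [OccurrenceShape, h]

theorem OccurrenceShape.exists_outside (hPn : ∀ i j, P i j → i < n ∧ j < n) {i j : ℕ}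
    (h : OccurrenceShape n s k l P i j) : ∃ f g, IsOccurrence s k l P f g ∧
      ∀ p, k ≤ p → p < l → i < f p ∧ j < g p ∧ ¬ OccurrenceShape n s k l P (f p) (g p) := by
  induction hm : 2 * n - (i + j) using Nat.strong_induction_on generalizing i j with
  | _ m ih =>
    obtain ⟨hi, hj, f, g, h1, h2⟩ := h
    by_cases hex : ∃ p, k ≤ p ∧ p < l ∧ OccurrenceShape n s k l P (f p) (g p)
    · obtain ⟨p, hp, hp', h3⟩ := hex
      have h4 := h2 p hp hp'
      have h5 := hPn _ _ (h1.1 p hp hp')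
      obtain ⟨f', g', h6, h7⟩ := ih (2 * n - (f p + g p)) (by omega) h3 rfl
      refine ⟨f', g', h6, fun q hq hq' => ?_⟩
      have h8 := h7 q hq hq'
      exact ⟨by omega, by omega, h8.2.2⟩
    · push Not at hex
      exact ⟨f, g, h1, fun p hp hp' => ⟨(h2 p hp hp').1, (h2 p hp hp').2, hex p hp hp'⟩⟩

theorem occurrenceShape_eq (hPn : ∀ i j, P i j → i < n ∧ j < n)
    (h : ∀ i j, ¬ OccurrenceShape n s k l P i j → (P i j ↔ P' i j)) :
    OccurrenceShape n s k l P = OccurrenceShape n s k l P' := by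
  ext i j
  constructor
  · intro hij
    obtain ⟨f, g, h1, h2⟩ := hij.exists_outside hPn
    exact ⟨hij.1, hij.2.1, f, g,
      ⟨fun p hp hp' => (h _ _ (h2 p hp hp').2.2).1 (h1.1 p hp hp'), h1.2⟩,
      fun p hp hp' => ⟨(h2 p hp hp').1, (h2 p hp hp').2.1⟩⟩
  · rintro ⟨hi, hj, f, g, h1, h2⟩
    by_contra hij
    refine hij ⟨hi, hj, f, g, ⟨fun p hp hp' => (h _ _ fun h3 => hij ?_).2 (h1.1 p hp hp'), h1.2⟩, h2⟩
    exact isDownShape_occurrenceShape _ _ _ _ h3 (h2 p hp hp').1.le (h2 p hp hp').2.le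

theorem exists_isOccurrence_iff (hk : 1 ≤ k) (hkl : k ≤ l) (hPn : ∀ i j, P i j → i < n ∧ j < n)
    (hs : ∀ p < k, s p < k) (hs' : ∀ p, k ≤ p → p < l → k ≤ s p) :
    (∃ f g, IsOccurrence s 0 l P f g) ↔ ∃ i j, OccurrenceShape n s k l P i j ∧
      ∃ f g, IsOccurrence s 0 k P f g ∧ ∀ p < k, f p ≤ i ∧ g p ≤ j := by
  constructor
  · rintro ⟨f, g, h1, h2⟩
    obtain ⟨p₀, hp₀, hmax⟩ := (Finset.range k).exists_max_image g ⟨0, Finset.mem_range.2 hk⟩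
    simp only [Finset.mem_range] at hp₀ hmax
    refine ⟨f (k - 1), g p₀, ⟨(hPn _ _ (h1 (k - 1) (by omega) (by omega))).1,
      (hPn _ _ (h1 p₀ (by omega) (by omega))).2, f, g, ⟨fun p _ hp => h1 p (by omega) hp,
        fun p q _ hpq hq => h2 p q (by omega) hpq hq⟩, fun p hp hp' => ⟨?_, ?_⟩⟩, f, g,
        ⟨fun p _ hp => h1 p (by omega) (by omega), fun p q _ hpq hq =>
          h2 p q (by omega) hpq (by omega)⟩, fun p hp => ⟨?_, hmax p hp⟩⟩
    · exact (h2 (k - 1) p (by omega) (by omega) hp').1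
    · exact (h2 p₀ p (by omega) (by omega) hp').2.2 ((hs p₀ hp₀).trans_le (hs' p hp hp'))
    · rcases Nat.eq_or_lt_of_le (Nat.le_sub_one_of_lt hp) with rfl | h3
      · exact le_rfl
      · exact (h2 p (k - 1) (by omega) h3 (by omega)).1.le
  · rintro ⟨i, j, ⟨-, -, f, g, ⟨h1, h2⟩, h3⟩, f', g', ⟨h4, h5⟩, h6⟩
    refine ⟨fun p => if p < k then f' p else f p, fun p => if p < k then g' p else g p,
      fun p _ hp => ?_, fun p q _ hpq hq => ?_⟩
    · grind
    · by_cases hqk : q < k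
      · simp only [hqk, hpq.trans hqk, if_true]
        exact h5 p q (by omega) hpq hqk
      · by_cases hpk : p < k
        · simp only [hqk, hpk, if_true, if_false]
          have h7 := h6 p hpk
          have h8 := h3 q (by omega) hq
          have h9 := hs p hpk
          have h10 := hs' q (by omega) hq
          omega
        · simp only [hqk, hpk, if_false]
          exact h2 p q (by omega) hpq hq

theorem exists_isOccurrence_iff_incChain (hs : ∀ p < k, s p = p) (i j : ℕ) :
    (∃ f g, IsOccurrence s 0 k P f g ∧ ∀ p < k, f p ≤ i ∧ g p ≤ j) ↔
      IncChain P k (i + 1) (j + 1) := by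
  rw [incChain_iff_exists]
  refine exists₂_congr fun f g => ?_
  constructor
  · rintro ⟨⟨h1, h2⟩, h3⟩
    refine ⟨fun p hp => ⟨h1 p (by omega) hp, by have := h3 p hp; omega, by have := h3 p hp; omega⟩,
      fun p q hpq hq => ?_⟩
    have := h2 p q (by omega) hpq hq
    rwa [hs p (by omega), hs q hq, iff_true_right hpq] at this
  · rintro ⟨h1, h2⟩
    refine ⟨⟨fun p _ hp => (h1 p hp).1, fun p q _ hpq hq => ?_⟩,
      fun p hp => by have := h1 p hp; omega⟩
    rw [hs p (by omega), hs q hq, iff_true_right hpq]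
    exact h2 p q hpq hq

theorem exists_isOccurrence_iff_decChain (hP : IsPartialPerm P) (hs : ∀ p < k, s p = k - 1 - p)
    (i j : ℕ) : (∃ f g, IsOccurrence s 0 k P f g ∧ ∀ p < k, f p ≤ i ∧ g p ≤ j) ↔
      DecChain P k (i + 1) 0 (j + 1) := by
  rw [decChain_iff_exists]
  refine exists₂_congr fun f g => ?_
  constructor
  · rintro ⟨⟨h1, h2⟩, h3⟩
    refine ⟨fun p hp => ⟨h1 p (by omega) hp, by have := h3 p hp; omega, by omega,
      by have := h3 p hp; omega⟩, fun p q hpq hq => ?_⟩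
    have h4 := h2 p q (by omega) hpq hq
    rw [hs p (by omega), hs q hq] at h4
    have h5 : g p ≠ g q := fun h => by
      have h6 := h1 p (by omega) (by omega)
      rw [h] at h6
      exact h4.1.ne (hP.2 _ _ _ h6 (h1 q (by omega) hq))
    omega
  · rintro ⟨h1, h2⟩
    refine ⟨⟨fun p _ hp => (h1 p hp).1, fun p q _ hpq hq => ?_⟩,
      fun p hp => by have := h1 p hp; omega⟩
    have h3 := h2 p q hpq hq
    rw [hs p (by omega), hs q hq]
    omega

end Shape

/-- The graph of a permutation, as a relation on `ℕ`. -/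
def permGraph {n : ℕ} (π : Equiv.Perm (Fin n)) (i j : ℕ) : Prop :=
  ∃ hi : i < n, (π ⟨i, hi⟩ : ℕ) = j

/-- The one-line notation of a permutation, extended by zero. -/
def permWord {l : ℕ} (σ : Equiv.Perm (Fin l)) (p : ℕ) : ℕ :=
  if h : p < l then σ ⟨p, h⟩ else 0

section Perm

variable {n l : ℕ}

theorem permGraph_lt (π : Equiv.Perm (Fin n)) (i j : ℕ) (h : permGraph π i j) : i < n ∧ j < n := by
  obtain ⟨hi, rfl⟩ := h
  exact ⟨hi, (π _).2⟩

theorem isPartialPerm_permGraph (π : Equiv.Perm (Fin n)) : IsPartialPerm (permGraph π) := by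
  constructor
  · rintro i j j' ⟨_, rfl⟩ ⟨_, rfl⟩
    rfl
  · rintro i i' j ⟨hi, h⟩ ⟨hi', h'⟩
    have := π.injective (Fin.ext (h.trans h'.symm))
    simpa using this

theorem permGraph_injective : Function.Injective (permGraph (n := n)) := by
  intro π π' h
  ext i
  have h1 : permGraph π i (π i) := ⟨i.2, rfl⟩
  rw [h] at h1
  obtain ⟨_, h1⟩ := h1
  exact h1.symm

theorem exists_permGraph_eq {P : ℕ → ℕ → Prop} (hP : IsPartialPerm P)
    (hPn : ∀ i j, P i j → i < n ∧ j < n) (hex : ∀ i < n, ∃ j, P i j) :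
    ∃ π : Equiv.Perm (Fin n), permGraph π = P := by
  choose! f hf using hex
  have hinj : Function.Injective
      (fun i : Fin n => (⟨f i, (hPn _ _ (hf i i.2)).2⟩ : Fin n)) := by
    intro i i' h
    simp only [Fin.mk.injEq] at h
    have h1 := hf i i.2
    rw [h] at h1
    exact Fin.ext (hP.2 _ _ _ h1 (hf i' i'.2))
  refine ⟨Equiv.ofBijective _ (Finite.injective_iff_bijective.1 hinj), ?_⟩
  ext i j
  constructor
  · rintro ⟨hi, h⟩
    rw [← h]
    exact hf i hi
  · intro h
    exact ⟨(hPn _ _ h).1, hP.1 _ _ _ (hf i (hPn _ _ h).1) h⟩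

theorem pattContains_iff (σ : Equiv.Perm (Fin l)) (π : Equiv.Perm (Fin n)) :
    PattContains σ π ↔ ∃ f g, IsOccurrence (permWord σ) 0 l (permGraph π) f g := by
  constructor
  · rintro ⟨F, hF, h⟩
    refine ⟨fun p => if hp : p < l then F ⟨p, hp⟩ else 0,
      fun p => if hp : p < l then π (F ⟨p, hp⟩) else 0, fun p _ hp => ?_, fun p q _ hpq hq => ?_⟩
    · simp only [hp, dif_pos]
      exact ⟨(F _).2, rfl⟩
    · have hp := hpq.trans hq
      simp only [hp, hq, dif_pos, permWord]
      exact ⟨hF hpq, h ⟨p, hp⟩ ⟨q, hq⟩⟩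
  · rintro ⟨f, g, h1, h2⟩
    have h3 : ∀ p : Fin l, ∃ x : Fin n, (x : ℕ) = f p ∧ (π x : ℕ) = g p := fun p => by
      obtain ⟨hi, h⟩ := h1 p (Nat.zero_le _) p.2
      exact ⟨⟨f p, hi⟩, rfl, h⟩
    choose F hF hF' using h3
    have hmono : StrictMono F := fun p q hpq => by
      rw [Fin.lt_def, hF, hF]
      exact (h2 p q (Nat.zero_le _) hpq q.2).1
    have hlt : ∀ a b : Fin l, a < b → (π (F a) < π (F b) ↔ σ a < σ b) := fun a b hab => by
      have := (h2 a b (Nat.zero_le _) hab b.2).2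
      simpa [permWord, ← hF'] using this
    refine ⟨F, hmono, fun a b => ?_⟩
    rcases lt_trichotomy a b with hab | rfl | hab
    · exact hlt a b hab
    · simp
    · have h4 : π (F a) ≠ π (F b) := fun h => hab.ne' (hmono.injective (π.injective h))
      have h5 : σ a ≠ σ b := fun h => hab.ne' (σ.injective h)
      rw [← not_iff_not, not_lt, not_lt, h4.symm.le_iff_lt, h5.symm.le_iff_lt]
      exact hlt b a hab

/-- The permutation `π'` arises from `π` by transferring the part inside the shape `Y`. -/
def IsPermTransfer (Y : ℕ → ℕ → Prop) (π π' : Equiv.Perm (Fin n)) : Prop :=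
  IsTransfer Y (fun i j => permGraph π i j ∧ Y i j) (fun i j => permGraph π' i j ∧ Y i j) ∧
    ∀ i j, ¬ Y i j → (permGraph π i j ↔ permGraph π' i j)

theorem exists_isPermTransfer {Y : ℕ → ℕ → Prop} (hYd : IsDownShape Y)
    (hYn : ∀ i j, Y i j → i < n ∧ j < n) (π : Equiv.Perm (Fin n)) :
    ∃ π' : Equiv.Perm (Fin n), IsPermTransfer Y π π' := by
  have hπ := isPartialPerm_permGraph π
  have hA : IsPartialPerm fun i j => permGraph π i j ∧ Y i j := hπ.mono fun _ _ h => h.1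
  obtain ⟨Q, hQ, hQY, hT⟩ := exists_isTransfer hYd n hYn hA
  have hrow := hT.exists_row_iff hYd hYn hA (fun _ _ h => h.2) hQ hQY
  have hcol := hT.exists_col_iff hYd hYn hA (fun _ _ h => h.2) hQ hQY
  have hex : ∃ π' : Equiv.Perm (Fin n),
      permGraph π' = fun i j => (permGraph π i j ∧ ¬ Y i j) ∨ Q i j := by
    refine exists_permGraph_eq ?_ ?_ ?_
    · constructor
      · rintro i j j' (⟨h1, h2⟩ | h1) (⟨h3, h4⟩ | h3)
        · exact hπ.1 _ _ _ h1 h3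
        · obtain ⟨j'', h5, h6⟩ := (hrow i).2 ⟨j', h3⟩
          exact absurd (hπ.1 _ _ _ h5 h1 ▸ h6) h2
        · obtain ⟨j'', h5, h6⟩ := (hrow i).2 ⟨j, h1⟩
          exact absurd (hπ.1 _ _ _ h5 h3 ▸ h6) h4
        · exact hQ.1 _ _ _ h1 h3
      · rintro i i' j (⟨h1, h2⟩ | h1) (⟨h3, h4⟩ | h3)
        · exact hπ.2 _ _ _ h1 h3
        · obtain ⟨j'', h5, h6⟩ := (hcol j).2 ⟨i', h3⟩
          exact absurd (hπ.2 _ _ _ h5 h1 ▸ h6) h2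
        · obtain ⟨j'', h5, h6⟩ := (hcol j).2 ⟨i, h1⟩
          exact absurd (hπ.2 _ _ _ h5 h3 ▸ h6) h4
        · exact hQ.2 _ _ _ h1 h3
    · rintro i j (h | h)
      · exact permGraph_lt π i j h.1
      · exact hYn i j (hQY i j h)
    · intro i hi
      have h1 : permGraph π i (π ⟨i, hi⟩) := ⟨hi, rfl⟩
      by_cases h2 : Y i (π ⟨i, hi⟩)
      · obtain ⟨j, hj⟩ := (hrow i).1 ⟨_, h1, h2⟩
        exact ⟨j, Or.inr hj⟩
      · exact ⟨_, Or.inl ⟨h1, h2⟩⟩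
  obtain ⟨π', hπ'⟩ := hex
  have h1 : (fun i j => permGraph π' i j ∧ Y i j) = Q := by
    ext i j
    have := hQY i j
    rw [hπ']
    tauto
  refine ⟨π', by rwa [h1], fun i j hij => ?_⟩
  have := hQY i j
  rw [hπ']
  tauto

theorem IsPermTransfer.left_unique {Y : ℕ → ℕ → Prop} (hYd : IsDownShape Y)
    (hYn : ∀ i j, Y i j → i < n ∧ j < n) {π₁ π₂ π' : Equiv.Perm (Fin n)}
    (h₁ : IsPermTransfer Y π₁ π') (h₂ : IsPermTransfer Y π₂ π') : π₁ = π₂ := by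
  apply permGraph_injective
  ext i j
  by_cases h : Y i j
  · have := h₁.1.left_unique h₂.1 hYd hYn ((isPartialPerm_permGraph π₁).mono fun _ _ h => h.1)
      ((isPartialPerm_permGraph π₂).mono fun _ _ h => h.1) h
    simpa [h] using this
  · rw [h₁.2 i j h, h₂.2 i j h]

theorem IsPermTransfer.pattContains_iff {k : ℕ} (hk : 1 ≤ k) (hkl : k ≤ l)
    {σ σ' : Equiv.Perm (Fin l)}
    (hσ : ∀ p < k, permWord σ p = p) (hσ' : ∀ p < k, permWord σ' p = k - 1 - p)
    (hagree : ∀ p, k ≤ p → p < l → permWord σ p = permWord σ' p)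
    (hvals : ∀ p, k ≤ p → p < l → k ≤ permWord σ p) {π π' : Equiv.Perm (Fin n)}
    (h : IsPermTransfer (OccurrenceShape n (permWord σ) k l (permGraph π)) π π') :
    PattContains σ π ↔ PattContains σ' π' := by
  have hshape := (occurrenceShape_eq (permGraph_lt π) h.2).trans
    (occurrenceShape_congr hagree)
  rw [BackelinWestXin.pattContains_iff, BackelinWestXin.pattContains_iff,
    exists_isOccurrence_iff hk hkl (permGraph_lt π) (fun p hp => by rw [hσ p hp]; exact hp) hvals,
    exists_isOccurrence_iff hk hkl (permGraph_lt π') (fun p hp => by rw [hσ' p hp]; omega)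
      (fun p hp hp' => hagree p hp hp' ▸ hvals p hp hp'), ← hshape]
  simp only [exists_isOccurrence_iff_incChain hσ,
    exists_isOccurrence_iff_decChain (isPartialPerm_permGraph π') hσ']
  have hd : IsDownShape (OccurrenceShape n (permWord σ) k l (permGraph π)) :=
    isDownShape_occurrenceShape
  have key := h.1.exists_incChain_iff (fun i j h => ⟨h.1, h.2.1⟩)
    ((isPartialPerm_permGraph π).mono fun _ _ h => h.1)
    ((isPartialPerm_permGraph π').mono fun _ _ h => h.1) k
  refine Iff.trans ?_ (key.trans ?_)
  · refine exists₂_congr fun i j => and_congr_right fun hij => ?_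
    exact ⟨fun hc => hc.mono le_rfl le_rfl fun i' j' hi' hj' h' =>
      ⟨h', hd _ _ _ _ hij (by omega) (by omega)⟩,
      fun hc => hc.mono le_rfl le_rfl fun _ _ _ _ h' => h'.1⟩
  · refine exists₂_congr fun i j => and_congr_right fun hij => ?_
    exact ⟨fun hc => hc.mono le_rfl le_rfl le_rfl fun _ _ _ _ h' => h'.1,
      fun hc => hc.mono le_rfl le_rfl le_rfl fun i' j' hi' hj' h' =>
      ⟨h', hd _ _ _ _ hij (by omega) (by omega)⟩⟩

end Perm

end BackelinWestXin

/-- Backelin–West–Xin: the patterns `12⋯k τ` and `k(k-1)⋯1 τ` are Wilf-equivalent.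
Here `σ, σ' : Perm (Fin l)` (0-indexed) agree on positions `≥ k`, where they take
values `≥ k`; on positions `i < k`, `σ` takes the values `0,1,…,k-1` in increasing
order (`σ i = i`) and `σ'` takes them in decreasing order (`σ' i = k-1-i`). -/
theorem stmt_14 (k l : ℕ) (hk : 1 ≤ k) (hkl : k ≤ l)
    (σ σ' : Equiv.Perm (Fin l))
    (hσ : ∀ i : Fin l, (i : ℕ) < k → (σ i : ℕ) = (i : ℕ))
    (hσ' : ∀ i : Fin l, (i : ℕ) < k → (σ' i : ℕ) = k - 1 - (i : ℕ))
    (hagree : ∀ i : Fin l, k ≤ (i : ℕ) → σ i = σ' i)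
    (hvals : ∀ i : Fin l, k ≤ (i : ℕ) → k ≤ (σ i : ℕ)) :
    ∀ n : ℕ, avoidCount σ n = avoidCount σ' n := by
  have hw : ∀ p (hp : p < l), BackelinWestXin.permWord σ p = σ ⟨p, hp⟩ := fun p hp => dif_pos hp
  have hw' : ∀ p (hp : p < l), BackelinWestXin.permWord σ' p = σ' ⟨p, hp⟩ :=
    fun p hp => dif_pos hp
  intro n
  let Y (π : Equiv.Perm (Fin n)) : ℕ → ℕ → Prop := BackelinWestXin.OccurrenceShape n
    (BackelinWestXin.permWord σ) k l (BackelinWestXin.permGraph π)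
  have hYd : ∀ π, BackelinWestXin.IsDownShape (Y π) := fun π =>
    BackelinWestXin.isDownShape_occurrenceShape
  have hYn : ∀ π i j, Y π i j → i < n ∧ j < n := fun π i j h => ⟨h.1, h.2.1⟩
  choose F hF using fun π => BackelinWestXin.exists_isPermTransfer (hYd π) (hYn π) π
  have hshape : ∀ π, Y π = Y (F π) := fun π =>
    BackelinWestXin.occurrenceShape_eq (BackelinWestXin.permGraph_lt π) (hF π).2
  have hinj : Function.Injective F := fun π₁ π₂ h => by
    have h₁ := hF π₁
    have h₂ := hF π₂
    rw [hshape, h] at h₁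
    rw [hshape] at h₂
    exact h₁.left_unique (hYd _) (hYn _) h₂
  refine Nat.card_congr ((Equiv.ofBijective F (Finite.injective_iff_bijective.1 hinj)).subtypeEquiv
    fun π => not_congr ((hF π).pattContains_iff hk hkl ?_ ?_ ?_ ?_))
  · exact fun p hp => (hw p (by omega)).trans (hσ _ hp)
  · exact fun p hp => (hw' p (by omega)).trans (hσ' _ hp)
  · exact fun p hp hp' => by rw [hw p hp', hw' p hp', hagree _ hp]
  · exact fun p hp hp' => by rw [hw p hp']; exact hvals _ hp
end
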